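/- arXiv:1801.08776 — 5 statements merged into one kernel-verified Lean document; each statement's English description precedes it below -/
import Mathlib

section
/- Let u ≥ 2 be an integer, q a prime power with q ≡ 2^u + 1 (mod 2^{u+1}), t ≥ u+1 an integer, N = 2^t and f = 2^{t−u}. Let ω be a primitive element of F_{q^f}, γ = ω^{(q^f−1)/(q−1)}, χ_N a multiplicative character of F_{q^f} of order N, χ' the multiplicative character of F_q of order 2^u with χ_N^{2^{t−u}}(x) = χ'(x^{(q^f−1)/(q−1)}), η' the quadratic character of F_q, and let b be an integer such that G_{q^f}(χ_N) = χ'(γ)^{−b} q^{f/2−1} G_q(χ') G_q(η'). Set D_h = ∪_{j=0}^{N/2−1} C_{h+j}^{(N,q^f)} and B_0 = ∪_{j=0}^{2^{u−1}−1} C_j^{(2^u,q)} (cyclotomic classes with respect to ω and γ respectively). For 0 ≤ a,h ≤ N−1, let j be the unique element of {0,1,…,2^{t−u}−1} with 2^{t−u} dividing a+h+j and set j_{a,h} = (a+h+j)/2^{t−u}. Then ψ_{F_{q^f}}(ω^a D_h) · conj(ψ_{F_{q^f}}(ω^a D_h)) = (1 − q^{f−1})/4 + q^{f−1} · ψ_{F_q}(γ^{b+j_{a,h}}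 B_0) · conj(ψ_{F_q}(γ^{b+j_{a,h}} B_0)). -/
open Finset
open scoped Classical

/-- The cyclotomic class `C_i^{(N,Q)} = γ^i ⟨γ^N⟩ = {γ^(i+Nj) : j ≥ 0}`. -/
noncomputable def cycClass {F : Type} [Field F] [Fintype F] (γ : F) (N i : ℕ) : Finset F :=
  Finset.univ.filter (fun x => ∃ j : ℕ, x = γ ^ (i + N * j))

/-- The canonical additive character `ψ(x) = ζ_p^(Tr_{Q/p}(x))` of a finite
field, where `p` is the characteristic. -/
noncomputable def psiF (F : Type) [Field F] [Fintype F] : F → ℂ :=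
  letI := ZMod.algebra F (ringChar F)
  fun x => Complex.exp (2 * Real.pi * Complex.I *
    ((Algebra.trace (ZMod (ringChar F)) F x).val : ℂ) / (ringChar F : ℂ))

/-- The Gauss sum `G_Q(χ) = ∑_{x ∈ F_Q^*} χ(x) ψ(x)` with respect to the
canonical additive character. -/
noncomputable def gaussF {F : Type} [Field F] [Fintype F] (χ : MulChar F ℂ) : ℂ :=
  ∑ x ∈ (Finset.univ \ {0} : Finset F), χ x * psiF F x

open IntermediateField in
/-- Powers of a primitive `N`-th root of unity below the `φ(N)`-th are linearly independent over
the field of `n`-th roots of unity when `n` and `N` are coprime. -/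
theorem coeff_eq_zero_of_sum_mul_pow_eq_zero {n N : ℕ} [NeZero n] [NeZero N]
    (hnN : n.Coprime N) {ξ ζ : ℂ} (hξ : IsPrimitiveRoot ξ n) (hζ : IsPrimitiveRoot ζ N)
    (c : ℕ → ℂ) (hc : ∀ k, c k ∈ ℚ⟮ξ⟯)
    (hsum : ∑ k ∈ range N.totient, c k * ζ ^ k = 0) {k : ℕ} (hk : k < N.totient) :
    c k = 0 := by
  have hξi : IsIntegral ℚ ξ := (hξ.isIntegral (NeZero.pos n)).tower_top
  have hζi : IsIntegral ℚ⟮ξ⟯ ζ := (hζ.isIntegral (NeZero.pos N)).tower_top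
  have : FiniteDimensional ℚ ℚ⟮ξ⟯ := adjoin.finiteDimensional hξi
  have : FiniteDimensional ℚ⟮ξ⟯ ℚ⟮ξ⟯⟮ζ⟯ := adjoin.finiteDimensional hζi
  have : FiniteDimensional ℚ ℚ⟮ξ⟯⟮ζ⟯ := FiniteDimensional.trans ℚ ℚ⟮ξ⟯ ℚ⟮ξ⟯⟮ζ⟯
  have h1 : Module.finrank ℚ ℚ⟮ξ⟯ = n.totient := by
    rw [adjoin.finrank hξi, ← Polynomial.cyclotomic_eq_minpoly_rat hξ (NeZero.pos n),
      Polynomial.natDegree_cyclotomic]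
  have h2 : n.totient * N.totient ≤ Module.finrank ℚ ℚ⟮ξ⟯⟮ζ⟯ := by
    have hx : IsPrimitiveRoot (algebraMap ℚ⟮ξ⟯ ℚ⟮ξ⟯⟮ζ⟯ (AdjoinSimple.gen ℚ ξ)) n := by
      refine IsPrimitiveRoot.of_map_of_injective (f := algebraMap ℚ⟮ξ⟯⟮ζ⟯ ℂ) ?_
        (algebraMap ℚ⟮ξ⟯⟮ζ⟯ ℂ).injective
      simpa using hξ
    have hy : IsPrimitiveRoot (AdjoinSimple.gen ℚ⟮ξ⟯ ζ) N := by
      refine IsPrimitiveRoot.of_map_of_injective (f := algebraMap ℚ⟮ξ⟯⟮ζ⟯ ℂ) ?_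
        (algebraMap ℚ⟮ξ⟯⟮ζ⟯ ℂ).injective
      simpa using hζ
    have := hx.lcm_totient_le_finrank hy (K := ℚ)
      (Polynomial.cyclotomic.irreducible_rat (Nat.lcm_pos (NeZero.pos n) (NeZero.pos N)))
    rwa [Nat.Coprime.lcm_eq_mul hnN, Nat.totient_mul hnN] at this
  have h3 : N.totient ≤ (minpoly ℚ⟮ξ⟯ ζ).natDegree := by
    rw [← Module.finrank_mul_finrank ℚ ℚ⟮ξ⟯ ℚ⟮ξ⟯⟮ζ⟯, h1, adjoin.finrank hζi] at h2
    exact Nat.le_of_mul_le_mul_left h2 (Nat.totient_pos.2 (NeZero.pos n))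
  have hli := (linearIndependent_pow (K := ℚ⟮ξ⟯) ζ).comp (Fin.castLE h3)
    (Fin.castLE_injective h3)
  have := Fintype.linearIndependent_iff.1 hli (fun i => ⟨c i, hc i⟩) (by
    rw [← hsum, ← Fin.sum_univ_eq_sum_range (fun k => c k * ζ ^ k)]
    rfl) ⟨k, hk⟩
  exact congrArg Subtype.val this

theorem psiF_spec (E : Type) [Field E] [Fintype E] :
    ∃ ψ : AddChar E ℂ, ψ.IsPrimitive ∧ ∀ x, psiF E x = ψ x := by
  have hp : Fact (ringChar E).Prime := ⟨CharP.char_is_prime E _⟩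
  let : Algebra (ZMod (ringChar E)) E := ZMod.algebra E (ringChar E)
  refine ⟨(ZMod.stdAddChar (N := ringChar E)).compAddMonoidHom
    (Algebra.trace (ZMod (ringChar E)) E).toAddMonoidHom, ?_, fun x => ?_⟩
  · obtain ⟨a, ha⟩ := FiniteField.trace_to_zmod_nondegenerate E one_ne_zero
    rw [one_mul] at ha
    refine AddChar.IsPrimitive.of_ne_one (AddChar.ne_one_iff.2 ⟨a, fun hf => ha ?_⟩)
    exact ((ZMod.isPrimitive_stdAddChar (ringChar E)).zmod_char_eq_one_iff (ringChar E) _).1 hf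
  · simp only [psiF, AddChar.compAddMonoidHom_apply, ZMod.stdAddChar_apply]
    exact (ZMod.toCircle_apply _).symm

theorem gaussF_eq_gaussSum {E : Type} [Field E] [Fintype E] {ψ : AddChar E ℂ}
    (hψ : ∀ x, psiF E x = ψ x) (χ : MulChar E ℂ) : gaussF χ = gaussSum χ ψ := by
  rw [gaussF, gaussSum, ← Finset.sum_sdiff (subset_univ {0})]
  simp [hψ, MulCharClass.map_nonunit χ not_isUnit_zero]

/-- If `q - 1` has 2-adic valuation `u ≥ 2`, then `q ^ 2 ^ s - 1` has 2-adic valuation `u + s`. -/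
theorem exists_pow_two_pow_eq {u q : ℕ} (hu : 2 ≤ u) (hmod : q % 2 ^ (u + 1) = 2 ^ u + 1) (s : ℕ) :
    ∃ c, q ^ 2 ^ s = 1 + 2 ^ (u + s) * (2 * c + 1) := by
  induction s with
  | zero =>
    refine ⟨q / 2 ^ (u + 1), ?_⟩
    have := Nat.div_add_mod q (2 ^ (u + 1))
    rw [hmod, pow_succ] at this
    rw [pow_zero, pow_one, add_zero, pow_succ]
    linarith
  | succ s ih =>
    obtain ⟨c, hc⟩ := ih
    obtain ⟨v, rfl⟩ := Nat.exists_eq_add_of_le hu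
    refine ⟨c + 2 ^ (v + s) * (2 * c + 1) ^ 2, ?_⟩
    rw [pow_succ, pow_mul, hc]
    ring

/-- The sum of a periodic function over any full period is the same. -/
theorem sum_range_add_eq_of_periodic {φ : ℤ → ℂ} {n : ℕ} (hφ : ∀ k, φ (k + n) = φ k) (c : ℤ) :
    ∑ i ∈ range n, φ (c + i) = ∑ i ∈ range n, φ i := by
  have step : ∀ c : ℤ, ∑ i ∈ range n, φ (c + 1 + i) = ∑ i ∈ range n, φ (c + i) := fun c => by
    have h1 := Finset.sum_range_succ (fun i : ℕ => φ (c + i)) n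
    rw [Finset.sum_range_succ' (fun i : ℕ => φ (c + i)) n, hφ] at h1
    simp only [Nat.cast_zero, add_zero, add_left_inj] at h1
    rw [← h1]
    refine Finset.sum_congr rfl fun i _ => ?_
    push_cast
    ring_nf
  induction c using Int.induction_on with
  | zero => simp
  | succ c ih => rw [step, ih]
  | pred c ih => rw [← ih, ← step, sub_add_cancel]

theorem sum_range_mul_eq (f n : ℕ) (φ : ℕ → ℂ) :
    ∑ k ∈ range (f * n), φ k = ∑ l ∈ range n, ∑ i ∈ range f, φ (i + f * l) := by
  induction n with
  | zero => simp
  | succ n ih =>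
    rw [mul_add_one, Finset.sum_range_add, ih, Finset.sum_range_succ]
    simp only [add_comm]

/-- The Gauss period `ψ(g ^ k ⟨g ^ M⟩)`, where `w` is the order of `g ^ M`. -/
noncomputable def gaussPeriod {E : Type} [Field E] (ψ : AddChar E ℂ) (g : E) (M w : ℕ)
    (k : ℤ) : ℂ :=
  ∑ l ∈ range w, ψ (g ^ (k + M * l))

section Period

variable {E : Type} [Field E] {ψ : AddChar E ℂ} {g : E} {M w n : ℕ}

theorem gaussPeriod_add_period (hord : orderOf g = M * w) (hg0 : g ≠ 0) (k : ℤ) :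
    gaussPeriod ψ g M w (k + M) = gaussPeriod ψ g M w k := by
  have := sum_range_add_eq_of_periodic (φ := fun l => ψ (g ^ (k + M * l))) (n := w) (fun l => by
    have hg : g ^ (M * w : ℤ) = 1 := by
      rw [← Nat.cast_mul, zpow_natCast, ← hord, pow_orderOf_eq_one]
    simp only [mul_add, ← add_assoc]
    rw [zpow_add₀ hg0 _ (M * w : ℤ), hg, mul_one]) 1
  simp only [gaussPeriod, ← this]
  refine Finset.sum_congr rfl fun l _ => ?_
  ring_nf

theorem gaussPeriod_add_period_mul (hord : orderOf g = M * w) (hg0 : g ≠ 0) (k : ℤ) (s : ℕ) :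
    gaussPeriod ψ g M w (k + M * s) = gaussPeriod ψ g M w k := by
  induction s with
  | zero => simp
  | succ s ih =>
    rw [← ih, ← gaussPeriod_add_period hord hg0 (k + M * s)]
    push_cast
    ring_nf

theorem gaussPeriod_add_half [Finite E] (hord : orderOf g = 2 * n * w) (hg0 : g ≠ 0) (hn : 0 < n)
    (hw : Odd w) (k : ℤ) :
    gaussPeriod ψ g (2 * n) w (k + n) = starRingEnd ℂ (gaussPeriod ψ g (2 * n) w k) := by
  obtain ⟨s, hs⟩ := hw
  have hneg : g ^ (n * w) = -1 := by
    have h1 : g ^ (n * w) * g ^ (n * w) = 1 := by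
      rw [← pow_add, ← two_mul, ← mul_assoc, ← hord, pow_orderOf_eq_one]
    refine (mul_self_eq_one_iff.1 h1).resolve_left fun h => ?_
    have hpos : 0 < n * w := Nat.mul_pos hn (by omega)
    have := Nat.le_of_dvd hpos (orderOf_dvd_of_pow_eq_one h)
    rw [hord, mul_assoc] at this
    omega
  rw [← gaussPeriod_add_period_mul hord hg0 (k + n) s, gaussPeriod, gaussPeriod, map_sum]
  refine Finset.sum_congr rfl fun l _ => ?_
  rw [← AddChar.map_neg_eq_conj]
  congr 1
  have : (k + n + (2 * n : ℕ) * s + (2 * n : ℕ) * l : ℤ) = k + (2 * n : ℕ) * l + (n * w : ℕ) := by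
    rw [hs]; push_cast; ring
  rw [this, zpow_add₀ hg0, zpow_natCast, hneg, mul_neg_one]

/-- The difference of two opposite Gauss periods. -/
noncomputable def oppDiff (ψ : AddChar E ℂ) (g : E) (n w : ℕ) (k : ℤ) : ℂ :=
  gaussPeriod ψ g (2 * n) w k - gaussPeriod ψ g (2 * n) w (k + n)

theorem oppDiff_add (hord : orderOf g = 2 * n * w) (hg0 : g ≠ 0) (k : ℤ) :
    oppDiff ψ g n w (k + n) = -oppDiff ψ g n w k := by
  have := gaussPeriod_add_period (ψ := ψ) hord hg0 k
  rw [oppDiff, oppDiff, neg_sub, ← this]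
  push_cast
  ring_nf

theorem sum_sub_conj_eq [Finite E] (hord : orderOf g = 2 * n * w) (hg0 : g ≠ 0) (hn : 0 < n)
    (hw : Odd w) (c : ℤ) :
    ∑ i ∈ range n, gaussPeriod ψ g (2 * n) w (c + i) -
      starRingEnd ℂ (∑ i ∈ range n, gaussPeriod ψ g (2 * n) w (c + i)) =
        ∑ i ∈ range n, oppDiff ψ g n w (c + i) := by
  rw [map_sum, ← Finset.sum_sub_distrib]
  refine Finset.sum_congr rfl fun i _ => ?_
  rw [oppDiff, gaussPeriod_add_half hord hg0 hn hw]

variable [Fintype E]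

theorem sum_cycClass (hord : orderOf g = M * w) (hg0 : g ≠ 0) (i : ℕ) (φ : E → ℂ) :
    ∑ x ∈ cycClass g M i, φ x = ∑ l ∈ range w, φ (g ^ (i + M * l)) := by
  have hpos : 0 < M * w := hord ▸ orderOf_pos_iff.2 (isOfFinOrder_iff_pow_eq_one.2
    ⟨Fintype.card E - 1, by have := Fintype.one_lt_card (α := E); omega,
      FiniteField.pow_card_sub_one_eq_one g hg0⟩)
  have hM : 0 < M := Nat.pos_of_mul_pos_right hpos
  have hw : 0 < w := Nat.pos_of_mul_pos_left hpos
  have himg : cycClass g M i = (range w).image fun l => g ^ (i + M * l) := by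
    ext x
    simp only [cycClass, mem_filter, mem_univ, true_and, mem_image, mem_range]
    constructor
    · rintro ⟨l, rfl⟩
      refine ⟨l % w, Nat.mod_lt _ hw, ?_⟩
      rw [pow_add, pow_add, ← Nat.mul_mod_mul_left, ← hord, pow_mod_orderOf]
    · rintro ⟨l, -, rfl⟩
      exact ⟨l, rfl⟩
  rw [himg, Finset.sum_image]
  intro l hl l' hl' h
  simp only [coe_range, Set.mem_Iio] at hl hl'
  simp only [pow_add] at h
  have h := mul_left_cancel₀ (pow_ne_zero i hg0) h
  have := pow_injOn_Iio_orderOf (x := g)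
    (by rw [hord]; exact Nat.mul_lt_mul_of_pos_left hl hM : M * l < orderOf g)
    (by rw [hord]; exact Nat.mul_lt_mul_of_pos_left hl' hM : M * l' < orderOf g) h
  exact Nat.eq_of_mul_eq_mul_left hM this

theorem cycClass_disjoint (hord : orderOf g = M * w) (hg0 : g ≠ 0) {i i' : ℕ}
    (h : ¬ i ≡ i' [MOD M]) : Disjoint (cycClass g M i) (cycClass g M i') := by
  rw [Finset.disjoint_left]
  simp only [cycClass, mem_filter, mem_univ, true_and]
  rintro x ⟨l, rfl⟩ ⟨l', hl⟩
  have hfin : IsOfFinOrder g := isOfFinOrder_iff_pow_eq_one.2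
    ⟨Fintype.card E - 1, by have := Fintype.one_lt_card (α := E); omega,
      FiniteField.pow_card_sub_one_eq_one g hg0⟩
  have h2 := (hfin.pow_eq_pow_iff_modEq.1 hl).of_dvd (Dvd.intro w hord.symm)
  apply h
  simpa [Nat.ModEq] using h2

theorem sum_biUnion_cycClass (hord : orderOf g = M * w) (hg0 : g ≠ 0) (hn : n ≤ M)
    (h : ℕ) (c : ℤ) :
    ∑ x ∈ (range n).biUnion (fun i => cycClass g M (h + i)), ψ (g ^ c * x) =
      ∑ i ∈ range n, gaussPeriod ψ g M w (c + h + i) := by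
  rw [Finset.sum_biUnion]
  · refine Finset.sum_congr rfl fun i _ => ?_
    rw [sum_cycClass hord hg0, gaussPeriod]
    refine Finset.sum_congr rfl fun l _ => ?_
    rw [← zpow_natCast, ← zpow_add₀ hg0]
    push_cast
    ring_nf
  · intro i hi i' hi' hne
    simp only [coe_range, Set.mem_Iio] at hi hi'
    refine cycClass_disjoint hord hg0 fun hmod => hne ?_
    exact Nat.ModEq.eq_of_lt_of_lt (Nat.ModEq.add_left_cancel' h hmod) (hi.trans_le hn)
      (hi'.trans_le hn)

theorem sum_ne_zero_eq (hord : orderOf g = M * w) (hgen : ∀ x : E, x ≠ 0 → ∃ m : ℕ, x = g ^ m)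
    (hg0 : g ≠ 0) (hM : 0 < M) (φ : E → ℂ) :
    ∑ x ∈ univ \ {0}, φ x = ∑ i ∈ range M, ∑ l ∈ range w, φ (g ^ (i + M * l)) := by
  have : (univ \ {0} : Finset E) = (range M).biUnion fun i => cycClass g M i := by
    ext x
    simp only [mem_sdiff, mem_univ, mem_singleton, true_and, mem_biUnion, mem_range, cycClass,
      mem_filter]
    constructor
    · intro hx
      obtain ⟨m, rfl⟩ := hgen x hx
      exact ⟨m % M, Nat.mod_lt _ hM, m / M, by rw [Nat.mod_add_div]⟩
    · rintro ⟨i, -, l, rfl⟩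
      exact pow_ne_zero _ hg0
  rw [this, Finset.sum_biUnion]
  · exact Finset.sum_congr rfl fun i _ => sum_cycClass hord hg0 i φ
  · intro i hi i' hi' hne
    simp only [coe_range, Set.mem_Iio] at hi hi'
    exact cycClass_disjoint hord hg0 fun hmod => hne (Nat.ModEq.eq_of_lt_of_lt hmod hi hi')

theorem sum_gaussPeriod_eq_neg_one (hord : orderOf g = M * w)
    (hgen : ∀ x : E, x ≠ 0 → ∃ m : ℕ, x = g ^ m) (hg0 : g ≠ 0) (hM : 0 < M)
    (hψ : ψ ≠ 1) (c : ℤ) :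
    ∑ i ∈ range M, gaussPeriod ψ g M w (c + i) = -1 := by
  rw [sum_range_add_eq_of_periodic (gaussPeriod_add_period hord hg0) c]
  have h1 := sum_ne_zero_eq hord hgen hg0 hM ψ
  have h2 := AddChar.sum_eq_zero_of_ne_one hψ
  rw [← Finset.sum_sdiff (subset_univ {0}), h1, Finset.sum_singleton, AddChar.map_zero_eq_one] at h2
  rw [← eq_neg_of_add_eq_zero_left h2]
  simp only [gaussPeriod]
  exact_mod_cast rfl

/-- The sum of a half period of Gauss periods has real part `-1/2`. -/
theorem sum_add_conj_eq_neg_one (hord : orderOf g = 2 * n * w)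
    (hgen : ∀ x : E, x ≠ 0 → ∃ m : ℕ, x = g ^ m) (hg0 : g ≠ 0) (hn : 0 < n) (hw : Odd w)
    (hψ : ψ ≠ 1) (c : ℤ) :
    ∑ i ∈ range n, gaussPeriod ψ g (2 * n) w (c + i) +
      starRingEnd ℂ (∑ i ∈ range n, gaussPeriod ψ g (2 * n) w (c + i)) = -1 := by
  rw [← sum_gaussPeriod_eq_neg_one hord hgen hg0 (by omega) hψ c, two_mul n,
    Finset.sum_range_add, map_sum]
  congr 1
  refine Finset.sum_congr rfl fun i _ => ?_
  rw [← two_mul, ← gaussPeriod_add_half hord hg0 hn hw]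
  push_cast
  ring_nf

theorem gaussSum_eq_sum_oppDiff (hord : orderOf g = 2 * n * w)
    (hgen : ∀ x : E, x ≠ 0 → ∃ m : ℕ, x = g ^ m) (hg0 : g ≠ 0) (hn : 0 < n)
    (χ : MulChar E ℂ) (hχ : χ g ^ n = -1) :
    gaussSum χ ψ = ∑ i ∈ range n, χ g ^ i * oppDiff ψ g n w i := by
  have hper : ∀ l : ℕ, χ g ^ (2 * n * l) = 1 := fun l => by
    rw [pow_mul, mul_comm 2, pow_mul, hχ]; norm_num
  have h1 : gaussSum χ ψ = ∑ i ∈ range (2 * n), χ g ^ i * gaussPeriod ψ g (2 * n) w i := by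
    rw [gaussSum, ← Finset.sum_sdiff (subset_univ {0}), Finset.sum_singleton,
      MulCharClass.map_nonunit χ not_isUnit_zero, zero_mul, add_zero,
      sum_ne_zero_eq hord hgen hg0 (by omega)]
    refine Finset.sum_congr rfl fun i _ => ?_
    rw [gaussPeriod, Finset.mul_sum]
    refine Finset.sum_congr rfl fun l _ => ?_
    rw [map_pow, pow_add, hper, mul_one]
    norm_cast
  rw [h1, two_mul, Finset.sum_range_add, ← Finset.sum_add_distrib]
  refine Finset.sum_congr rfl fun i _ => ?_
  rw [pow_add, hχ, oppDiff]
  push_cast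
  ring_nf

end Period

theorem orderOf_eq_card_sub_one {E : Type} [Field E] [Fintype E] {g : E} (hg0 : g ≠ 0)
    (hgen : ∀ x : E, x ≠ 0 → ∃ m : ℕ, x = g ^ m) : orderOf g = Fintype.card E - 1 := by
  rw [← Units.val_mk0 hg0, orderOf_units, orderOf_eq_card_of_forall_mem_zpowers,
    Nat.card_eq_fintype_card, Fintype.card_units]
  intro x
  obtain ⟨m, hm⟩ := hgen x x.ne_zero
  exact ⟨m, Units.ext (by simp [hm])⟩

theorem exists_eq_pow_of_orderOf_eq {E : Type} [Field E] [Fintype E] {g : E} (hg0 : g ≠ 0)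
    (hord : orderOf g = Fintype.card E - 1) (x : E) (hx : x ≠ 0) : ∃ m : ℕ, x = g ^ m := by
  have himg : (range (orderOf g)).image (g ^ ·) = univ \ {0} := by
    refine Finset.eq_of_subset_of_card_le ?_ ?_
    · intro y hy
      obtain ⟨m, -, rfl⟩ := mem_image.1 hy
      simp [hg0]
    · rw [Finset.card_image_of_injOn, card_range, hord, Finset.card_sdiff_of_subset (by simp)]
      · simp
      · simpa using pow_injOn_Iio_orderOf (x := g)
  have : x ∈ (range (orderOf g)).image (g ^ ·) := by simp [himg, hx]
  obtain ⟨m, -, rfl⟩ := mem_image.1 this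
  exact ⟨m, rfl⟩

theorem isPrimitiveRoot_mulChar_apply {E : Type} [Field E] {g : E} (hg0 : g ≠ 0)
    (hgen : ∀ x : E, x ≠ 0 → ∃ m : ℕ, x = g ^ m) (χ : MulChar E ℂ) :
    IsPrimitiveRoot (χ g) (orderOf χ) := by
  have key : ∀ l : ℕ, (χ ^ l) (Units.mk0 g hg0) = χ g ^ l := fun l => by
    rw [MulChar.pow_apply_coe, Units.val_mk0]
  refine ⟨?_, fun l hl => orderOf_dvd_of_pow_eq_one (MulChar.ext fun a => ?_)⟩
  · rw [← key, pow_orderOf_eq_one, MulChar.one_apply_coe]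
  · obtain ⟨m, hm⟩ := hgen a a.ne_zero
    rw [MulChar.pow_apply_coe, hm, ← hm, MulChar.one_apply_coe, hm, map_pow, ← pow_mul, mul_comm,
      pow_mul, hl, one_pow]

section Membership

open IntermediateField

variable {E : Type} [Field E] {p : ℕ} [NeZero p] [CharP E p] {ξ : ℂ}

theorem addChar_apply_mem_adjoin (hξ : IsPrimitiveRoot ξ p) (ψ : AddChar E ℂ) (x : E) :
    ψ x ∈ ℚ⟮ξ⟯ := by
  have h : ψ x ^ p = 1 := by
    rw [← AddChar.map_nsmul_eq_pow, nsmul_eq_mul, CharP.cast_eq_zero, zero_mul,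
      AddChar.map_zero_eq_one]
  obtain ⟨i, -, hi⟩ := hξ.eq_pow_of_pow_eq_one h
  exact hi ▸ pow_mem (mem_adjoin_simple_self ℚ ξ) i

theorem oppDiff_mem_adjoin (hξ : IsPrimitiveRoot ξ p) (ψ : AddChar E ℂ) (g : E) (n w : ℕ)
    (k : ℤ) : oppDiff ψ g n w k ∈ ℚ⟮ξ⟯ :=
  sub_mem (sum_mem fun _ _ => addChar_apply_mem_adjoin hξ ψ _)
    (sum_mem fun _ _ => addChar_apply_mem_adjoin hξ ψ _)

theorem gaussSum_quadratic_mem_adjoin [Fintype E] (hξ : IsPrimitiveRoot ξ p) (ψ : AddChar E ℂ)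
    {η : MulChar E ℂ} (hη : η ^ 2 = 1) : gaussSum η ψ ∈ ℚ⟮ξ⟯ := by
  refine sum_mem fun x _ => mul_mem ?_ (addChar_apply_mem_adjoin hξ ψ x)
  rcases eq_or_ne x 0 with rfl | hx
  · rw [MulCharClass.map_nonunit η not_isUnit_zero]
    exact zero_mem _
  · have h : η x ^ 2 = 1 := by
      rw [← MulChar.pow_apply' η two_ne_zero, hη, MulChar.one_apply (isUnit_iff_ne_zero.2 hx)]
    rcases sq_eq_one_iff.1 h with h | h <;> rw [h]
    · exact one_mem _
    · exact neg_mem (one_mem _)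

end Membership

theorem antiperiodic_eq_zero {δ : ℤ → ℂ} {m : ℕ} (hm : 0 < m) (hδ : ∀ k, δ (k + m) = -δ k)
    (h0 : ∀ k < m, δ (k : ℕ) = 0) (k : ℤ) : δ k = 0 := by
  have key : ∀ z k : ℤ, δ (k + m * z) = 0 ↔ δ k = 0 := by
    intro z
    induction z using Int.induction_on with
    | zero => simp
    | succ z ih => intro k; rw [← ih k, mul_add_one, ← add_assoc, hδ, neg_eq_zero]
    | pred z ih =>
      intro k
      rw [← ih k, show k + m * -(z : ℤ) = k + m * (-(z : ℤ) - 1) + m by ring, hδ, neg_eq_zero]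
  rw [← Int.emod_add_mul_ediv k m, key]
  have hm' : (m : ℤ) ≠ 0 := by omega
  have h1 := Int.emod_nonneg k hm'
  have h2 := Int.emod_lt_of_pos k (by omega : (0 : ℤ) < m)
  lift k % m to ℕ using h1 with r
  exact h0 r (by omega)

/-- A sum over a range of length `f * n` of terms supported on the multiples of `f`. -/
theorem sum_range_mul_ite_dvd {f : ℕ} (hf : 0 < f) (n : ℕ) (φ : ℕ → ℂ) (v : ℤ → ℂ) (c : ℤ) {j : ℕ}
    (hj : j < f) (hdvd : (f : ℤ) ∣ c + j) :
    ∑ k ∈ range (f * n), φ k * (if (f : ℤ) ∣ c + k then v ((c + k) / f) else 0) =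
      ∑ l ∈ range n, φ (j + f * l) * v ((c + j) / f + l) := by
  rw [sum_range_mul_eq]
  refine Finset.sum_congr rfl fun l _ => ?_
  have hf' : (f : ℤ) ≠ 0 := by omega
  rw [Finset.sum_eq_single j]
  · have h : (c + (j + f * l : ℕ) : ℤ) = c + j + f * l := by push_cast; ring
    rw [h, if_pos (hdvd.add (dvd_mul_right _ _)), Int.add_mul_ediv_left _ _ hf']
  · intro i hi hne
    rw [if_neg, mul_zero]
    intro h
    have h1 : (f : ℤ) ∣ i - j := by
      rw [show (i - j : ℤ) = (c + (i + f * l : ℕ)) - (c + j) - f * l by push_cast; ring]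
      exact (h.sub hdvd).sub (dvd_mul_right (f : ℤ) l)
    have hi' := mem_range.1 hi
    have := Int.eq_zero_of_abs_lt_dvd h1 (by rw [abs_lt]; constructor <;> omega)
    omega
  · intro h
    exact absurd (mem_range.2 hj) h

open IntermediateField in
/-- Comparing coefficients of powers of `ζ` in a factorisation of Gauss sums expresses the
differences of opposite periods of the large field through those of the small field. -/
theorem sum_eq_mul_sum_of_sum_pow_eq {p N f n : ℕ} [NeZero p] [NeZero N] (hpN : p.Coprime N)
    (hf : 0 < f) (hN : N.totient = f * n) {ξ ζ : ℂ} (hξ : IsPrimitiveRoot ξ p)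
    (hζ : IsPrimitiveRoot ζ N) (hζn : ζ ^ (f * n) = -1) {d e : ℤ → ℂ} {R : ℂ}
    (hd : ∀ k, d (k + (f * n : ℕ)) = -d k) (he : ∀ k, e (k + n) = -e k)
    (hdξ : ∀ k, d k ∈ ℚ⟮ξ⟯) (heξ : ∀ k, e k ∈ ℚ⟮ξ⟯) (hR : R ∈ ℚ⟮ξ⟯) (b : ℤ)
    (hsum : ∑ k ∈ range (f * n), ζ ^ k * d k =
      (ζ ^ f) ^ (-b) * R * ∑ m ∈ range n, (ζ ^ f) ^ m * e m)
    (c : ℤ) {j : ℕ} (hj : j < f) (hdvd : (f : ℤ) ∣ c + j) :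
    ∑ k ∈ range (f * n), d (c + k) = R * ∑ l ∈ range n, e (b + (c + j) / f + l) := by
  set v : ℤ → ℂ := fun k => R * e (b + k) with hv
  set e' : ℤ → ℂ := fun k => if (f : ℤ) ∣ k then v (k / f) else 0 with he'
  have hf' : (f : ℤ) ≠ 0 := by omega
  have hζ0 : ζ ≠ 0 := hζ.ne_zero (NeZero.ne N)
  have hε0 : ζ ^ f ≠ 0 := pow_ne_zero _ hζ0
  have hfn : 0 < f * n := hN ▸ Nat.totient_pos.2 (NeZero.pos N)
  have hant : ∀ k, e' (k + (f * n : ℕ)) = -e' k := by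
    intro k
    simp only [he', hv]
    push_cast
    rw [Int.add_mul_ediv_left _ _ hf', ← add_assoc, he]
    simp only [dvd_add_left (dvd_mul_right (f : ℤ) n)]
    split_ifs <;> simp
  have hsum' : ∑ k ∈ range (f * n), ζ ^ k * e' k =
      (ζ ^ f) ^ (-b) * R * ∑ m ∈ range n, (ζ ^ f) ^ m * e m := by
    have h1 := sum_range_mul_ite_dvd hf n (fun k => ζ ^ k) v 0 hf (by simp)
    simp only [zero_add, Nat.cast_zero, Int.zero_ediv] at h1
    rw [h1]
    have h2 := sum_range_add_eq_of_periodic (n := n) (φ := fun m : ℤ => (ζ ^ f) ^ m * e m)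
      (fun k => by rw [zpow_add₀ hε0, zpow_natCast _ n, ← pow_mul, hζn, he]; ring) b
    simp only [zpow_natCast] at h2
    rw [← h2, Finset.mul_sum]
    refine Finset.sum_congr rfl fun l _ => ?_
    rw [zpow_add₀ hε0, zpow_natCast, zpow_neg, pow_mul]
    simp only [hv]
    field_simp
  have hde : ∀ k, d k = e' k := by
    intro k
    refine sub_eq_zero.1 (antiperiodic_eq_zero (δ := fun k => d k - e' k) hfn ?_ ?_ k)
    · intro k
      simp only [hd, hant]
      ring
    · intro k hk
      refine coeff_eq_zero_of_sum_mul_pow_eq_zero hpN hξ hζ (fun k : ℕ => d k - e' k) ?_ ?_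
        (hN ▸ hk)
      · intro k
        refine sub_mem (hdξ _) ?_
        simp only [he']
        split_ifs
        · exact mul_mem hR (heξ _)
        · exact zero_mem _
      · rw [hN]
        simp only [mul_comm _ (ζ ^ _), mul_sub, Finset.sum_sub_distrib]
        rw [hsum, hsum', sub_self]
  have h3 := sum_range_mul_ite_dvd hf n (fun _ => 1) v c hj hdvd
  simp only [one_mul] at h3
  simp only [hde]
  rw [h3, Finset.mul_sum]
  refine Finset.sum_congr rfl fun l _ => ?_
  simp only [hv, add_assoc]

/-- **Products of character values of `D_h`.**  With the notation of the paper: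
`ψ_{F_{q^f}}(ω^a D_h) ⋅ conj(ψ_{F_{q^f}}(ω^a D_h)) = (1 - q^(f-1))/4
    + q^(f-1) ψ_{F_q}(γ^(b+j_{a,h}) B_0) ⋅ conj(ψ_{F_q}(γ^(b+j_{a,h}) B_0))`. -/
theorem character_value_products_of_Dh
    (u : ℕ) (hu : 2 ≤ u) (q : ℕ) (hq : IsPrimePow q)
    (hmod : q % 2 ^ (u + 1) = 2 ^ u + 1)
    (t : ℕ) (ht : u + 1 ≤ t)
    (F K : Type) [Field F] [Fintype F] [Field K] [Fintype K]
    (hF : Fintype.card F = q) (hK : Fintype.card K = q ^ (2 ^ (t - u)))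
    (ι : F →+* K)
    (ω : K) (hω : ∀ x : K, x ≠ 0 → ∃ n : ℕ, x = ω ^ n)
    (γ : F) (hγ : ι γ = ω ^ ((q ^ (2 ^ (t - u)) - 1) / (q - 1)))
    (χN : MulChar K ℂ) (hχN : orderOf χN = 2 ^ t)
    (χ' : MulChar F ℂ) (hχ' : orderOf χ' = 2 ^ u)
    (hlift : ∀ (x : K) (y : F), ι y = x ^ ((q ^ (2 ^ (t - u)) - 1) / (q - 1)) →
      (χN ^ (2 ^ (t - u))) x = χ' y)
    (η' : MulChar F ℂ) (hη' : orderOf η' = 2)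
    (b : ℤ)
    (hb : gaussF χN = (χ' γ) ^ (-b) * (q : ℂ) ^ (2 ^ (t - u) / 2 - 1) *
      gaussF χ' * gaussF η')
    (D : ℕ → Finset K)
    (hD : ∀ h, D h = (Finset.range (2 ^ t / 2)).biUnion
            (fun j => cycClass ω (2 ^ t) (h + j)))
    (B₀ : Finset F)
    (hB₀ : B₀ = (Finset.range (2 ^ (u - 1))).biUnion
            (fun j => cycClass γ (2 ^ u) j))
    (a h : ℕ) (ha : a ≤ 2 ^ t - 1) (hh : h ≤ 2 ^ t - 1)
    (j : ℕ) (hj : j < 2 ^ (t - u)) (hjdvd : 2 ^ (t - u) ∣ a + h + j) :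
    (∑ x ∈ D h, psiF K (ω ^ a * x)) *
        (starRingEnd ℂ) (∑ x ∈ D h, psiF K (ω ^ a * x)) =
      (1 - (q : ℂ) ^ (2 ^ (t - u) - 1)) / 4 +
        (q : ℂ) ^ (2 ^ (t - u) - 1) *
          ((∑ x ∈ B₀, psiF F (γ ^ (b + (((a + h + j) / 2 ^ (t - u) : ℕ) : ℤ)) * x)) *
            (starRingEnd ℂ)
              (∑ x ∈ B₀, psiF F (γ ^ (b + (((a + h + j) / 2 ^ (t - u) : ℕ) : ℤ)) * x))) := by
  obtain ⟨s, hs0, rfl⟩ : ∃ s, 0 < s ∧ t = u + s := ⟨t - u, by omega, by omega⟩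
  obtain ⟨v, rfl⟩ : ∃ v, u = v + 1 := ⟨u - 1, by omega⟩
  obtain ⟨r, rfl⟩ : ∃ r, s = r + 1 := ⟨s - 1, by omega⟩
  simp only [Nat.add_sub_cancel_left, Nat.add_sub_cancel] at *
  set f := 2 ^ (r + 1) with hf_def
  set n := 2 ^ v with hn_def
  have hf : 0 < f := by positivity
  have hn : 0 < n := by positivity
  have hM : 2 ^ (v + 1) = 2 * n := by rw [hn_def, pow_succ, mul_comm]
  have hN : 2 ^ (v + 1 + (r + 1)) = 2 * (f * n) := by rw [hn_def, hf_def]; ring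
  have hNtot : (2 ^ (v + 1 + (r + 1))).totient = f * n := by
    rw [show v + 1 + (r + 1) = v + (r + 1) + 1 by ring,
      Nat.totient_prime_pow_succ Nat.prime_two, hn_def, hf_def]
    ring
  obtain ⟨w, hqw, hw⟩ : ∃ w, q - 1 = 2 * n * w ∧ Odd w := by
    obtain ⟨c, hc⟩ := exists_pow_two_pow_eq hu hmod 0
    refine ⟨2 * c + 1, ?_, c, rfl⟩
    rw [pow_zero, pow_one, add_zero, hM] at hc
    omega
  obtain ⟨W, hqW, hW⟩ : ∃ W, q ^ f - 1 = 2 * (f * n) * W ∧ Odd W := by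
    obtain ⟨c, hc⟩ := exists_pow_two_pow_eq hu hmod (r + 1)
    refine ⟨2 * c + 1, ?_, c, rfl⟩
    rw [hN, ← hf_def] at hc
    rw [hc, Nat.add_sub_cancel_left]
  have hq1 : 0 < q - 1 := by rw [hqw]; exact Nat.mul_pos (by omega) hw.pos
  have hqodd : Odd q := ⟨n * w, by rw [← mul_assoc]; omega⟩
  set p := ringChar F with hp_def
  have hp : p.Prime := CharP.char_is_prime F p
  have hpF : CharP F p := ringChar.charP F
  have hpK : CharP K p := charP_of_injective_ringHom ι.injective p
  have hpne : NeZero p := ⟨hp.ne_zero⟩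
  have hp2 : p ≠ 2 := by
    intro h2
    obtain ⟨m, -, hm⟩ := FiniteField.card F p
    rw [hF, h2] at hm
    rw [hm] at hqodd
    exact absurd hqodd (Nat.not_odd_iff_even.2 (even_two.pow_of_ne_zero m.ne_zero))
  have hpN : p.Coprime (2 ^ (v + 1 + (r + 1))) :=
    ((Nat.coprime_primes hp Nat.prime_two).2 hp2).pow_right _
  have hω0 : ω ≠ 0 := by
    rintro rfl
    obtain ⟨m, hm⟩ := hω (-1) (by simp)
    have hne := Ring.neg_one_ne_one_of_char_ne_two (R := K) (by rwa [ringChar.eq K p])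
    rcases eq_or_ne m 0 with rfl | h0
    · exact hne (by simpa using hm)
    · simp [zero_pow h0] at hm
  have hωord : orderOf ω = 2 * (f * n) * W := by
    rw [orderOf_eq_card_sub_one hω0 hω, hK, hqW]
  have hγ0 : γ ≠ 0 := by
    rintro rfl
    rw [map_zero] at hγ
    exact pow_ne_zero _ hω0 hγ.symm
  have hγcard : orderOf γ = Fintype.card F - 1 := by
    have hdvd : q - 1 ∣ q ^ f - 1 := by simpa using Nat.sub_dvd_pow_sub_pow q 1 f
    have hpos : 0 < q ^ f - 1 := by
      rw [hqW]
      exact Nat.mul_pos (by positivity) hW.pos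
    rw [← orderOf_injective (ι : F →* K) ι.injective γ, MonoidHom.coe_coe, hγ,
      orderOf_pow_of_dvd (Nat.div_pos (Nat.le_of_dvd hpos hdvd) hq1).ne'
        (by rw [hωord, ← hqW]; exact Nat.div_dvd_of_dvd hdvd),
      hωord, ← hqW, Nat.div_div_self hdvd hpos.ne', hF]
  have hγgen := exists_eq_pow_of_orderOf_eq hγ0 hγcard
  have hγord : orderOf γ = 2 * n * w := by rw [hγcard, hF, hqw]
  obtain ⟨ψF, hψFprim, hψF⟩ := psiF_spec F
  obtain ⟨ψK, hψKprim, hψK⟩ := psiF_spec K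
  have hψF1 : ψF ≠ 1 := by simpa using hψFprim one_ne_zero
  have hψK1 : ψK ≠ 1 := by simpa using hψKprim one_ne_zero
  have hζ : IsPrimitiveRoot (χN ω) (2 ^ (v + 1 + (r + 1))) :=
    hχN ▸ isPrimitiveRoot_mulChar_apply hω0 hω χN
  have hζn : χN ω ^ (f * n) = -1 :=
    (hζ.pow (by positivity) (by rw [hN, mul_comm])).eq_neg_one_of_two_right
  have hε : χ' γ = χN ω ^ f := by
    rw [← hlift ω γ hγ, MulChar.pow_apply' _ hf.ne']
  have hεn : χ' γ ^ n = -1 := by rw [hε, ← pow_mul, hζn]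
  obtain ⟨ξ, hξ⟩ : ∃ ξ : ℂ, IsPrimitiveRoot ξ p := ⟨_, Complex.isPrimitiveRoot_exp p hp.ne_zero⟩
  have hη1 : η' ≠ 1 := by
    rintro rfl
    simp at hη'
  set R : ℂ := (q : ℂ) ^ (f / 2 - 1) * gaussSum η' ψF with hR_def
  have hR : R ∈ IntermediateField.adjoin ℚ {ξ} :=
    mul_mem (pow_mem (natCast_mem _ q) _)
      (gaussSum_quadratic_mem_adjoin hξ ψF (hη' ▸ pow_orderOf_eq_one η'))
  have hRR : R * starRingEnd ℂ R = (q : ℂ) ^ (f - 1) := by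
    have h1 := gaussSum_mul_gaussSum_eq_card hη1 hψFprim
    rw [← star_gaussSum_eq, hF] at h1
    have h2 : f - 1 = (f / 2 - 1) + (f / 2 - 1) + 1 := by
      have : 0 < 2 ^ r := by positivity
      rw [hf_def, pow_succ]
      omega
    rw [hR_def, map_mul, map_pow, Complex.conj_natCast, h2, pow_succ, pow_add, ← h1,
      starRingEnd_apply]
    ring
  rw [gaussF_eq_gaussSum hψK, gaussF_eq_gaussSum hψF, gaussF_eq_gaussSum hψF,
    gaussSum_eq_sum_oppDiff hωord hω hω0 (Nat.mul_pos hf hn) χN hζn,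
    gaussSum_eq_sum_oppDiff hγord hγgen hγ0 hn χ' hεn, hε] at hb
  have hdvd : (f : ℤ) ∣ (a + h : ℤ) + j := by exact_mod_cast hjdvd
  have key := sum_eq_mul_sum_of_sum_pow_eq hpN hf hNtot hξ hζ hζn
    (oppDiff_add hωord hω0) (oppDiff_add hγord hγ0) (oppDiff_mem_adjoin hξ ψK ω _ _)
    (oppDiff_mem_adjoin hξ ψF γ _ _) hR b (by rw [hb, hR_def]; ring) (a + h) hj hdvd
  rw [← sum_sub_conj_eq hωord hω0 (Nat.mul_pos hf hn) hW,
    ← sum_sub_conj_eq hγord hγ0 hn hw] at key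
  have hX := sum_add_conj_eq_neg_one hωord hω hω0 (Nat.mul_pos hf hn) hW hψK1 (a + h)
  have hY := sum_add_conj_eq_neg_one hγord hγgen hγ0 hn hw hψF1 (b + ((a + h : ℤ) + j) / f)
  have hXeq : ∑ x ∈ D h, psiF K (ω ^ a * x) =
      ∑ i ∈ range (f * n), gaussPeriod ψK ω (2 * (f * n)) W (a + h + i) := by
    rw [hD, hN, Nat.mul_div_cancel_left _ two_pos,
      ← sum_biUnion_cycClass hωord hω0 (by omega) h a]
    simp only [hψK, zpow_natCast]
  have hYeq : ∑ x ∈ B₀, psiF F (γ ^ (b + (((a + h + j) / f : ℕ) : ℤ)) * x) =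
      ∑ i ∈ range n, gaussPeriod ψF γ (2 * n) w (b + ((a + h : ℤ) + j) / f + i) := by
    have := sum_biUnion_cycClass (ψ := ψF) (n := n) hγord hγ0 (by omega) 0
      (b + ((a + h : ℤ) + j) / f)
    simp only [zero_add, Nat.cast_zero, add_zero] at this
    rw [hB₀, hM, ← this]
    simp only [hψF]
    push_cast
    rfl
  rw [hXeq, hYeq]
  generalize ∑ i ∈ range (f * n), gaussPeriod ψK ω (2 * (f * n)) W (a + h + i) = X at *
  generalize ∑ i ∈ range n, gaussPeriod ψF γ (2 * n) w (b + ((a + h : ℤ) + j) / f + i) = Y at *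
  have hX' : starRingEnd ℂ X = -1 - X := by linear_combination hX
  have hY' : starRingEnd ℂ Y = -1 - Y := by linear_combination hY
  have hmul : (X - starRingEnd ℂ X) * starRingEnd ℂ (X - starRingEnd ℂ X) =
      (R * (Y - starRingEnd ℂ Y)) * starRingEnd ℂ (R * (Y - starRingEnd ℂ Y)) := by rw [key]
  simp only [map_mul, map_sub, hX', hY', map_neg, map_one] at hmul
  rw [hX', hY', ← hRR]
  linear_combination hmul / 4
end

section
/- Let (G,+) be a finite abelian group of order v = 2m+1 and let {B_1, B_2, B_3, B_4} be a difference family in G with parameters (2m+1, m, 2(m−1)) such that B_1 is skew. Let M_1, M_2, M_4 be the type-1 matrices of B_1, B_2, B_4 respectively and M_3 the type-2 matrix of B_3 (with respect to a fixed ordering of G). Then the (4v+4)×(4v+4) block matrix H with rows of blocks [[1, −1, −1, −1, −1ᵀ, −1ᵀ, −1ᵀ, −1ᵀ], [1, 1, 1, −1, 1ᵀ, −1ᵀ, 1ᵀ, −1ᵀ], [1, −1, 1, 1, 1ᵀ, −1ᵀ, −1ᵀ, 1ᵀ], [1, 1, −1, 1, 1ᵀ, 1ᵀ, −1ᵀ,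 −1ᵀ], [1, −1, −1, −1, −M_1, −M_2, −M_3, −M_4], [1, 1, 1, −1, M_2ᵀ, −M_1ᵀ, M_4, −M_3], [1, −1, 1, 1, M_3, −M_4ᵀ, −M_1, M_2ᵀ], [1, 1, −1, 1, M_4ᵀ, M_3, −M_2, −M_1ᵀ]] (where the scalar entries 1, −1 in the last four block-rows stand for the all-ones column vector 1_v and its negative, and 1ᵀ, −1ᵀ in the first four block-rows stand for the all-ones row vector of length v and its negative) is a skew Hadamard matrix of order 8(m+1). -/
open Finset Matrix
open scoped Classical

/-- The type-1 matrix of a subset `X` of a finite abelian group `G`: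
the `(i,j)` entry is `1` if `j - i ∈ X` and `-1` otherwise. -/
noncomputable def type1Matrix (G : Type) [AddCommGroup G] [Fintype G]
    (X : Finset G) : Matrix G G ℝ :=
  fun i j => if j - i ∈ X then 1 else -1

/-- The type-2 matrix of a subset `X` of a finite abelian group `G`:
the `(i,j)` entry is `1` if `j + i ∈ X` and `-1` otherwise. -/
noncomputable def type2Matrix (G : Type) [AddCommGroup G] [Fintype G]
    (X : Finset G) : Matrix G G ℝ :=
  fun i j => if j + i ∈ X then 1 else -1

/-- Which of the four `G`-blocks an index belongs to. -/
def blockIdx (G : Type) : (G ⊕ G) ⊕ (G ⊕ G) → Fin 4 :=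
  Sum.elim (Sum.elim (fun _ => 0) (fun _ => 1)) (Sum.elim (fun _ => 2) (fun _ => 3))

/-- The Wallis–Whiteman array of Proposition 1.3. -/
noncomputable def H4 (G : Type) [AddCommGroup G] [Fintype G]
    (B₁ B₂ B₃ B₄ : Finset G) :
    Matrix (Fin 4 ⊕ ((G ⊕ G) ⊕ (G ⊕ G))) (Fin 4 ⊕ ((G ⊕ G) ⊕ (G ⊕ G))) ℝ :=
  Matrix.fromBlocks
    !![1, -1, -1, -1; 1, 1, 1, -1; 1, -1, 1, 1; 1, 1, -1, 1]
    (fun i x => (!![-1, -1, -1, -1; 1, -1, 1, -1; 1, -1, -1, 1; 1, 1, -1, -1] :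
      Matrix (Fin 4) (Fin 4) ℝ) i (blockIdx G x))
    (fun x j => (!![1, -1, -1, -1; 1, 1, 1, -1; 1, -1, 1, 1; 1, 1, -1, 1] :
      Matrix (Fin 4) (Fin 4) ℝ) (blockIdx G x) j)
    (Matrix.fromBlocks
      (Matrix.fromBlocks
        (-(type1Matrix G B₁)) (-(type1Matrix G B₂))
        ((type1Matrix G B₂)ᵀ) (-(type1Matrix G B₁)ᵀ))
      (Matrix.fromBlocks
        (-(type2Matrix G B₃)) (-(type1Matrix G B₄))
        (type1Matrix G B₄) (-(type2Matrix G B₃)))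
      (Matrix.fromBlocks
        (type2Matrix G B₃) (-(type1Matrix G B₄)ᵀ)
        ((type1Matrix G B₄)ᵀ) (type2Matrix G B₃))
      (Matrix.fromBlocks
        (-(type1Matrix G B₁)) ((type1Matrix G B₂)ᵀ)
        (-(type1Matrix G B₂)) (-(type1Matrix G B₁)ᵀ)))

section FourBlocks

variable {G : Type} [AddCommGroup G] [Fintype G]

theorem type1Matrix_transpose (X : Finset G) :
    (type1Matrix G X)ᵀ = type1Matrix G (X.image fun x => -x) := by
  ext i j
  have : (j - i ∈ X.image fun x => -x) ↔ i - j ∈ X := by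
    simp [neg_eq_iff_eq_neg]
  simp only [type1Matrix, transpose_apply, this]

theorem type2Matrix_transpose (X : Finset G) : (type2Matrix G X)ᵀ = type2Matrix G X := by
  ext i j
  simp only [type2Matrix, transpose_apply, add_comm]

theorem type1Matrix_mul_comm (X Y : Finset G) :
    type1Matrix G X * type1Matrix G Y = type1Matrix G Y * type1Matrix G X := by
  ext i j
  simp only [mul_apply, type1Matrix]
  refine Fintype.sum_equiv (Equiv.subLeft (i + j)) _ _ fun k => ?_
  rw [mul_comm, Equiv.subLeft_apply, show i + j - k - i = j - k by abel,
    show j - (i + j - k) = k - i by abel]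

theorem type2Matrix_mul_type1Matrix_transpose (X Y : Finset G) :
    type2Matrix G X * (type1Matrix G Y)ᵀ = type1Matrix G Y * type2Matrix G X := by
  ext i j
  simp only [mul_apply, type1Matrix, type2Matrix, transpose_apply]
  refine Fintype.sum_equiv (Equiv.addRight (i - j)) _ _ fun k => ?_
  rw [mul_comm, Equiv.coe_addRight, show k + (i - j) - i = k - j by abel,
    show j + (k + (i - j)) = k + i by abel]

theorem type2Matrix_mul_type1Matrix (X Y : Finset G) :
    type2Matrix G X * type1Matrix G Y = (type1Matrix G Y)ᵀ * type2Matrix G X := by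
  have h := type2Matrix_mul_type1Matrix_transpose X (Y.image fun x => -x)
  rwa [← type1Matrix_transpose, transpose_transpose] at h

theorem sum_sign_indicator {α : Type*} [Fintype α] (X : Finset α) :
    ∑ t, (if t ∈ X then (1 : ℝ) else -1) = 2 * X.card - Fintype.card α := by
  have h (t : α) : (if t ∈ X then (1 : ℝ) else -1) = 2 * (if t ∈ X then 1 else 0) - 1 := by
    split_ifs <;> norm_num
  simp only [h, sum_sub_distrib, ← mul_sum]
  simp

theorem sum_type1Matrix_row (X : Finset G) (i : G) :
    ∑ j, type1Matrix G X i j = 2 * X.card - Fintype.card G := by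
  rw [← sum_sign_indicator]
  exact Fintype.sum_equiv (Equiv.subRight i) _ _ fun k => rfl

theorem sum_type1Matrix_col (X : Finset G) (j : G) :
    ∑ i, type1Matrix G X i j = 2 * X.card - Fintype.card G := by
  rw [← sum_sign_indicator]
  exact Fintype.sum_equiv (Equiv.subLeft j) _ _ fun k => rfl

theorem sum_type2Matrix_row (X : Finset G) (i : G) :
    ∑ j, type2Matrix G X i j = 2 * X.card - Fintype.card G := by
  rw [← sum_sign_indicator]
  exact Fintype.sum_equiv (Equiv.addRight i) _ _ fun k => rfl

theorem sum_sign_indicator_mul_shift (X : Finset G) {g : G} (hg : g ≠ 0) :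
    ∑ t, (if t ∈ X then (1 : ℝ) else -1) * (if t + g ∈ X then 1 else -1) =
      4 * ((X ×ˢ X).filter (fun p => p.1 ≠ p.2 ∧ p.1 - p.2 = g)).card - 4 * X.card
        + Fintype.card G := by
  have hcard : ((X ×ˢ X).filter (fun p => p.1 ≠ p.2 ∧ p.1 - p.2 = g)).card =
      (univ.filter fun t => t ∈ X ∧ t + g ∈ X).card := by
    refine card_bij' (fun p _ => p.2) (fun t _ => (t + g, t)) ?_ ?_ ?_ ?_
    · rintro ⟨a, b⟩ h
      simp only [mem_filter, mem_product] at h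
      obtain ⟨⟨ha, hb⟩, -, rfl⟩ := h
      simp [ha, hb]
    · intro t h
      simp only [mem_filter, mem_univ, true_and] at h
      simp [h, hg]
    · rintro ⟨a, b⟩ h
      simp only [mem_filter] at h
      simp [← h.2.2]
    · intro t _
      rfl
  have hshift : ∑ t, (if t + g ∈ X then (1 : ℝ) else -1) = 2 * X.card - Fintype.card G := by
    rw [← sum_sign_indicator]
    exact Fintype.sum_equiv (Equiv.addRight g) _ _ fun k => rfl
  have hprod (t : G) : (if t ∈ X then (1 : ℝ) else -1) * (if t + g ∈ X then 1 else -1) =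
      4 * (if t ∈ X ∧ t + g ∈ X then 1 else 0) - (if t ∈ X then (1 : ℝ) else -1)
        - (if t + g ∈ X then (1 : ℝ) else -1) - 1 := by
    by_cases h₁ : t ∈ X <;> by_cases h₂ : t + g ∈ X <;> norm_num [h₁, h₂]
  rw [hcard]
  simp only [hprod, sum_sub_distrib, ← mul_sum, hshift, sum_sign_indicator, sum_boole]
  simp
  ring

theorem type1Matrix_mul_transpose_apply (X : Finset G) (i j : G) :
    (type1Matrix G X * (type1Matrix G X)ᵀ) i j =
      ∑ t, (if t ∈ X then (1 : ℝ) else -1) * (if t + (i - j) ∈ X then 1 else -1) := by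
  simp only [mul_apply, type1Matrix, transpose_apply]
  refine Fintype.sum_equiv (Equiv.subRight i) _ _ fun k => ?_
  rw [Equiv.subRight_apply, show k - i + (i - j) = k - j by abel]

theorem type2Matrix_mul_self_apply (X : Finset G) (i j : G) :
    (type2Matrix G X * type2Matrix G X) i j =
      ∑ t, (if t ∈ X then (1 : ℝ) else -1) * (if t + (i - j) ∈ X then 1 else -1) := by
  simp only [mul_apply, type2Matrix]
  refine Fintype.sum_equiv (Equiv.addLeft j) _ _ fun k => ?_
  rw [mul_comm, Equiv.coe_addLeft, show j + k + (i - j) = k + i by abel]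

theorem sum_gram_of_differenceFamily {m : ℕ}
    (hG : Fintype.card G = 2 * m + 1) (B₁ B₂ B₃ B₄ : Finset G)
    (hB₁ : B₁.card = m) (hB₂ : B₂.card = m) (hB₃ : B₃.card = m) (hB₄ : B₄.card = m)
    (hDF : ∀ g : G, g ≠ 0 →
      ((B₁ ×ˢ B₁).filter (fun p => p.1 ≠ p.2 ∧ p.1 - p.2 = g)).card +
      ((B₂ ×ˢ B₂).filter (fun p => p.1 ≠ p.2 ∧ p.1 - p.2 = g)).card +
      ((B₃ ×ˢ B₃).filter (fun p => p.1 ≠ p.2 ∧ p.1 - p.2 = g)).card +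
      ((B₄ ×ˢ B₄).filter (fun p => p.1 ≠ p.2 ∧ p.1 - p.2 = g)).card = 2 * (m - 1)) :
    type1Matrix G B₁ * (type1Matrix G B₁)ᵀ + type1Matrix G B₂ * (type1Matrix G B₂)ᵀ +
      type2Matrix G B₃ * type2Matrix G B₃ + type1Matrix G B₄ * (type1Matrix G B₄)ᵀ =
      (8 * (m + 1) : ℝ) • (1 : Matrix G G ℝ) - of fun _ _ => 4 := by
  have hGR : (Fintype.card G : ℝ) = 2 * m + 1 := by exact_mod_cast hG
  ext i j
  simp only [Matrix.add_apply, Matrix.sub_apply, Matrix.smul_apply, of_apply, type1Matrix_mul_transpose_apply,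
    type2Matrix_mul_self_apply, smul_eq_mul]
  by_cases hij : i = j
  · subst hij
    have hsq (X : Finset G) (t : G) :
        (if t ∈ X then (1 : ℝ) else -1) * (if t ∈ X then 1 else -1) = 1 := by
      split_ifs <;> norm_num
    simp only [sub_self, add_zero, hsq, one_apply_eq, sum_const, card_univ, nsmul_eq_mul, hGR]
    ring
  · have hg : i - j ≠ 0 := sub_ne_zero.mpr hij
    have hm : 1 ≤ m := by
      have : 1 < Fintype.card G := Fintype.one_lt_card_iff.mpr ⟨i, j, hij⟩
      omega
    have h := congrArg (Nat.cast : ℕ → ℝ) (hDF _ hg)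
    push_cast [Nat.cast_sub hm] at h
    simp only [sum_sign_indicator_mul_shift _ hg, hB₁, hB₂, hB₃, hB₄, hGR, one_apply_ne hij]
    linarith

theorem type1Matrix_add_transpose_of_skew {X : Finset G}
    (h : X ∩ X.image (fun x => -x) = ∅ ∧ X ∪ X.image (fun x => -x) = univ \ {0}) :
    (type1Matrix G X)ᵀ = -type1Matrix G X - (2 : ℝ) • 1 := by
  have hneg (g : G) : (g ∈ X.image fun x => -x) ↔ -g ∈ X := by
    simp [neg_eq_iff_eq_neg]
  have hand (g : G) : ¬(g ∈ X ∧ -g ∈ X) := by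
    rw [← hneg, ← mem_inter, h.1]
    exact notMem_empty g
  have hor (g : G) : g ∈ X ∨ -g ∈ X ↔ g ≠ 0 := by
    rw [← hneg, ← mem_union, h.2]
    simp
  ext i j
  have h₁ := hand (j - i)
  have h₂ := hor (j - i)
  rw [neg_sub] at h₁ h₂
  rw [sub_ne_zero] at h₂
  simp only [transpose_apply, Matrix.sub_apply, Matrix.neg_apply, Matrix.smul_apply, one_apply,
    type1Matrix]
  by_cases hij : i = j
  · subst hij
    have : i - i ∉ X := fun hx => h₁ ⟨hx, hx⟩
    rw [if_neg this, if_pos rfl]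
    norm_num
  · by_cases ha : j - i ∈ X
    · have hb : i - j ∉ X := fun hb => h₁ ⟨ha, hb⟩
      simp [ha, hb, hij]
    · have hb : i - j ∈ X := (h₂.mpr (Ne.symm hij)).resolve_left ha
      simp [ha, hb, hij]

/-- The sign pattern of the first four columns of `H4`. -/
def borderColSigns : Matrix (Fin 4) (Fin 4) ℝ :=
  !![1, -1, -1, -1; 1, 1, 1, -1; 1, -1, 1, 1; 1, 1, -1, 1]

/-- The sign pattern of the first four rows of `H4` beyond the fourth column. -/
def borderRowSigns : Matrix (Fin 4) (Fin 4) ℝ :=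
  !![-1, -1, -1, -1; 1, -1, 1, -1; 1, -1, -1, 1; 1, 1, -1, -1]

/-- The block matrix left after removing the first four rows and columns of `H4`. -/
noncomputable def coreMatrix (B₁ B₂ B₃ B₄ : Finset G) :
    Matrix ((G ⊕ G) ⊕ (G ⊕ G)) ((G ⊕ G) ⊕ (G ⊕ G)) ℝ :=
  Matrix.fromBlocks
    (Matrix.fromBlocks
      (-(type1Matrix G B₁)) (-(type1Matrix G B₂))
      ((type1Matrix G B₂)ᵀ) (-(type1Matrix G B₁)ᵀ))
    (Matrix.fromBlocks
      (-(type2Matrix G B₃)) (-(type1Matrix G B₄))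
      (type1Matrix G B₄) (-(type2Matrix G B₃)))
    (Matrix.fromBlocks
      (type2Matrix G B₃) (-(type1Matrix G B₄)ᵀ)
      ((type1Matrix G B₄)ᵀ) (type2Matrix G B₃))
    (Matrix.fromBlocks
      (-(type1Matrix G B₁)) ((type1Matrix G B₂)ᵀ)
      (-(type1Matrix G B₂)) (-(type1Matrix G B₁)ᵀ))

theorem H4_eq_fromBlocks (B₁ B₂ B₃ B₄ : Finset G) :
    H4 G B₁ B₂ B₃ B₄ = fromBlocks borderColSigns (borderRowSigns.submatrix id (blockIdx G))
      (borderColSigns.submatrix (blockIdx G) id) (coreMatrix B₁ B₂ B₃ B₄) := rfl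

theorem borderColSigns_mul_transpose : borderColSigns * borderColSignsᵀ = (4 : ℝ) • 1 := by
  ext i j
  fin_cases i <;> fin_cases j <;>
    simp [borderColSigns, mul_apply, Fin.sum_univ_four] <;> norm_num

theorem borderRowSigns_mul_transpose : borderRowSigns * borderRowSignsᵀ = (4 : ℝ) • 1 := by
  ext i j
  fin_cases i <;> fin_cases j <;>
    simp [borderRowSigns, mul_apply, Fin.sum_univ_four] <;> norm_num

theorem submatrix_blockIdx_mul_transpose {α : Type} [Fintype α]
    (T : Matrix (Fin 4) (Fin 4) ℝ) :
    T.submatrix id (blockIdx α) * (T.submatrix id (blockIdx α))ᵀ =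
      (Fintype.card α : ℝ) • (T * Tᵀ) := by
  ext i j
  simp [mul_apply, Fin.sum_univ_four, blockIdx]
  ring

theorem submatrix_blockIdx_mul_coreMatrix_transpose (T : Matrix (Fin 4) (Fin 4) ℝ)
    {B₁ B₂ B₃ B₄ : Finset G} {s : ℝ}
    (h₁ : 2 * (B₁.card : ℝ) - Fintype.card G = s) (h₂ : 2 * (B₂.card : ℝ) - Fintype.card G = s)
    (h₃ : 2 * (B₃.card : ℝ) - Fintype.card G = s) (h₄ : 2 * (B₄.card : ℝ) - Fintype.card G = s) :
    T.submatrix id (blockIdx G) * (coreMatrix B₁ B₂ B₃ B₄)ᵀ =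
      s • (T * borderRowSignsᵀ).submatrix id (blockIdx G) := by
  ext i ((x | x) | (x | x)) <;>
    simp [mul_apply, Fin.sum_univ_four, blockIdx, coreMatrix, borderRowSigns, ← mul_sum,
      sum_type1Matrix_row, sum_type1Matrix_col, sum_type2Matrix_row, h₁, h₂, h₃, h₄] <;>
    ring

theorem coreMatrix_mul_transpose {B₁ B₂ B₃ B₄ : Finset G} {S : Matrix G G ℝ}
    (hS : type1Matrix G B₁ * (type1Matrix G B₁)ᵀ + type1Matrix G B₂ * (type1Matrix G B₂)ᵀ +
      type2Matrix G B₃ * type2Matrix G B₃ + type1Matrix G B₄ * (type1Matrix G B₄)ᵀ = S) :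
    coreMatrix B₁ B₂ B₃ B₄ * (coreMatrix B₁ B₂ B₃ B₄)ᵀ =
      fromBlocks (fromBlocks S 0 0 S) 0 0 (fromBlocks S 0 0 S) := by
  have hcomm (X Y : Finset G) : (type1Matrix G X)ᵀ * type1Matrix G Y =
      type1Matrix G Y * (type1Matrix G X)ᵀ := by
    rw [type1Matrix_transpose, type1Matrix_mul_comm]
  have hcommT (X Y : Finset G) : (type1Matrix G X)ᵀ * (type1Matrix G Y)ᵀ =
      (type1Matrix G Y)ᵀ * (type1Matrix G X)ᵀ := by
    rw [← transpose_mul, type1Matrix_mul_comm, transpose_mul]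
  have hzero : (0 : Matrix (G ⊕ G) (G ⊕ G) ℝ) = fromBlocks 0 0 0 0 := fromBlocks_zero.symm
  rw [hzero]
  simp only [coreMatrix, fromBlocks_transpose, fromBlocks_multiply, fromBlocks_add,
    transpose_neg, transpose_transpose, type2Matrix_transpose, neg_mul, mul_neg, neg_neg,
    hcomm, type2Matrix_mul_type1Matrix_transpose, type2Matrix_mul_type1Matrix,
    type1Matrix_mul_comm B₂ B₁, type1Matrix_mul_comm B₄ B₁, type1Matrix_mul_comm B₄ B₂,
    hcommT B₂ B₁, hcommT B₄ B₁, hcommT B₄ B₂]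
  subst hS
  congr 2 <;> abel

end FourBlocks

/-- **(Wallis–Whiteman.)**  If `{B₁, B₂, B₃, B₄}` is a difference family with
parameters `(2m+1, m, 2(m-1))` in a finite abelian group `G` and `B₁` is skew,
then the array `H4` (built from the type-1 matrices of `B₁, B₂, B₄` and the
type-2 matrix of `B₃`) is a skew Hadamard matrix of order `8(m+1)`. -/
theorem skew_hadamard_from_four_blocks
    (G : Type) [AddCommGroup G] [Fintype G] (m : ℕ)
    (hG : Fintype.card G = 2 * m + 1)
    (B₁ B₂ B₃ B₄ : Finset G)
    (hB₁ : B₁.card = m) (hB₂ : B₂.card = m) (hB₃ : B₃.card = m) (hB₄ : B₄.card = m)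
    (hDF : ∀ g : G, g ≠ 0 →
      ((B₁ ×ˢ B₁).filter (fun p => p.1 ≠ p.2 ∧ p.1 - p.2 = g)).card +
      ((B₂ ×ˢ B₂).filter (fun p => p.1 ≠ p.2 ∧ p.1 - p.2 = g)).card +
      ((B₃ ×ˢ B₃).filter (fun p => p.1 ≠ p.2 ∧ p.1 - p.2 = g)).card +
      ((B₄ ×ˢ B₄).filter (fun p => p.1 ≠ p.2 ∧ p.1 - p.2 = g)).card = 2 * (m - 1))
    (hskew : B₁ ∩ B₁.image (fun x => -x) = ∅ ∧
      B₁ ∪ B₁.image (fun x => -x) = Finset.univ \ {0}) :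
    Fintype.card (Fin 4 ⊕ ((G ⊕ G) ⊕ (G ⊕ G))) = 8 * (m + 1) ∧
    (∀ i j, H4 G B₁ B₂ B₃ B₄ i j = 1 ∨ H4 G B₁ B₂ B₃ B₄ i j = -1) ∧
    H4 G B₁ B₂ B₃ B₄ * (H4 G B₁ B₂ B₃ B₄)ᵀ = ((8 * (m + 1) : ℕ) : ℝ) • 1 ∧
    (H4 G B₁ B₂ B₃ B₄ - 1)ᵀ = -(H4 G B₁ B₂ B₃ B₄ - 1) := by
  have hGR : (Fintype.card G : ℝ) = 2 * m + 1 := by exact_mod_cast hG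
  refine ⟨by simp; omega, ?_, ?_, ?_⟩
  · have htype1 (X : Finset G) (i j) : type1Matrix G X i j = 1 ∨ type1Matrix G X i j = -1 :=
      ite_eq_or_eq _ _ _
    have htype2 (X : Finset G) (i j) : type2Matrix G X i j = 1 ∨ type2Matrix G X i j = -1 :=
      ite_eq_or_eq _ _ _
    have hneg {a : ℝ} (ha : a = 1 ∨ a = -1) : -a = 1 ∨ -a = -1 := by
      rcases ha with rfl | rfl <;> simp
    have hcol (i j) : borderColSigns i j = 1 ∨ borderColSigns i j = -1 := by
      fin_cases i <;> fin_cases j <;> simp [borderColSigns]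
    have hrow (i j) : borderRowSigns i j = 1 ∨ borderRowSigns i j = -1 := by
      fin_cases i <;> fin_cases j <;> simp [borderRowSigns]
    rw [H4_eq_fromBlocks]
    rintro (i | i) (j | j)
    · exact hcol _ _
    · exact hrow _ _
    · exact hcol _ _
    · obtain ((i | i) | (i | i)) := i <;> obtain ((j | j) | (j | j)) := j <;>
        first
        | exact htype1 _ _ _
        | exact htype2 _ _ _
        | exact hneg (htype1 _ _ _)
        | exact hneg (htype2 _ _ _)
  · have hs : 2 * (m : ℝ) - Fintype.card G = -1 := by rw [hGR]; ring
    have hcross : borderColSigns * (borderColSigns.submatrix (blockIdx G) id)ᵀ +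
        borderRowSigns.submatrix id (blockIdx G) * (coreMatrix B₁ B₂ B₃ B₄)ᵀ = 0 := by
      have h : borderColSigns * (borderColSigns.submatrix (blockIdx G) id)ᵀ =
          (borderColSigns * borderColSignsᵀ).submatrix id (blockIdx G) := rfl
      rw [submatrix_blockIdx_mul_coreMatrix_transpose (s := -1) _ (by rwa [hB₁]) (by rwa [hB₂])
        (by rwa [hB₃]) (by rwa [hB₄]), h, borderColSigns_mul_transpose,
        borderRowSigns_mul_transpose, neg_one_smul, add_neg_cancel]
    have hcross' : borderColSigns.submatrix (blockIdx G) id * borderColSignsᵀ +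
        coreMatrix B₁ B₂ B₃ B₄ * (borderRowSigns.submatrix id (blockIdx G))ᵀ = 0 := by
      simpa using congrArg transpose hcross
    have hcol : borderColSigns.submatrix (blockIdx G) id *
        (borderColSigns.submatrix (blockIdx G) id)ᵀ =
        (borderColSigns * borderColSignsᵀ).submatrix (blockIdx G) (blockIdx G) := rfl
    rw [H4_eq_fromBlocks, fromBlocks_transpose, fromBlocks_multiply, hcross, hcross', hcol,
      submatrix_blockIdx_mul_transpose, coreMatrix_mul_transpose
        (sum_gram_of_differenceFamily hG B₁ B₂ B₃ B₄ hB₁ hB₂ hB₃ hB₄ hDF),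
      borderColSigns_mul_transpose, borderRowSigns_mul_transpose, ← fromBlocks_one,
      fromBlocks_smul, smul_zero, smul_zero, hGR]
    congr 1
    · ext i j
      simp only [Matrix.add_apply, Matrix.smul_apply, smul_eq_mul]
      push_cast
      ring
    · ext ((x | x) | (x | x)) ((y | y) | (y | y)) <;> simp [blockIdx, one_apply]
  · have hM (i j : G) : type1Matrix G B₁ i j = -type1Matrix G B₁ j i -
        2 * (1 : Matrix G G ℝ) j i := congrFun (congrFun
      (type1Matrix_add_transpose_of_skew hskew) j) i
    have hN (i j : G) : type2Matrix G B₃ i j = type2Matrix G B₃ j i :=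
      congrFun (congrFun (type2Matrix_transpose B₃) j) i
    have hcol : borderColSignsᵀ = (2 : ℝ) • 1 - borderColSigns := by
      ext i j
      fin_cases i <;> fin_cases j <;> norm_num [borderColSigns]
    have hrow : borderRowSignsᵀ = -borderColSigns := by
      ext i j
      fin_cases i <;> fin_cases j <;> simp [borderColSigns, borderRowSigns]
    have hcol' : borderColSignsᵀ.submatrix id (blockIdx G) =
        -borderRowSigns.submatrix id (blockIdx G) := by
      rw [← transpose_transpose borderRowSigns, hrow, transpose_neg, submatrix_neg]
      simp
    have hcore : (coreMatrix B₁ B₂ B₃ B₄)ᵀ = (2 : ℝ) • 1 - coreMatrix B₁ B₂ B₃ B₄ := by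
      ext ((i | i) | (i | i)) ((j | j) | (j | j)) <;>
        simp [coreMatrix, one_apply, hM j i, hN j i]
    have hH : (H4 G B₁ B₂ B₃ B₄)ᵀ = (2 : ℝ) • 1 - H4 G B₁ B₂ B₃ B₄ := by
      rw [H4_eq_fromBlocks, fromBlocks_transpose, transpose_submatrix, transpose_submatrix,
        hrow, hcol', hcol, hcore]
      ext (i | i) (j | j) <;> simp [one_apply]
    rw [transpose_sub, transpose_one, hH, two_smul]
    abel
end

section
/- If q is a prime power with q ≡ 5 (mod 8), then there exists a skew Hadamard difference family with two blocks in (F_q,+), i.e., two skew subsets of F_q of size (q−1)/2 forming a difference family with parameters (q, (q−1)/2, (q−3)/2). -/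
open Finset
open scoped Classical

/-- A subset `B` of a finite additive abelian group is *skew* if
`B ∩ (-B) = ∅` and `B ∪ (-B) = G \ {0}`. -/
def IsSkewSet {G : Type} [AddCommGroup G] [Fintype G] (B : Finset G) : Prop :=
  B ∩ B.image (fun x => -x) = ∅ ∧ B ∪ B.image (fun x => -x) = Finset.univ \ {0}

/-- `B` is a difference family with block size `k` and index `lam`. -/
def IsDiffFamily {G : Type} [AddCommGroup G] [Fintype G] {ℓ : ℕ}
    (B : Fin ℓ → Finset G) (k lam : ℕ) : Prop :=
  (∀ i, (B i).card = k) ∧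
  ∀ g : G, g ≠ 0 →
    (∑ i, (((B i) ×ˢ (B i)).filter (fun p => p.1 ≠ p.2 ∧ p.1 - p.2 = g)).card) = lam

section OddSignFunction

variable {G : Type} [AddCommGroup G] {f : G → ℤ}

lemma apply_zero_of_odd (hodd : ∀ x, f (-x) = -f x) : f 0 = 0 := by
  have h := hodd 0
  rw [neg_zero] at h
  omega

lemma two_mul_indicator_eq (hodd : ∀ x, f (-x) = -f x) (hsign : ∀ x, x ≠ 0 → f x = 1 ∨ f x = -1)
    (x : G) : 2 * (if f x = 1 then 1 else 0 : ℤ) = f x + 1 - (if x = 0 then 1 else 0) := by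
  by_cases hx : x = 0
  · simp [hx, apply_zero_of_odd hodd]
  · rcases hsign x hx with h | h <;> simp [hx, h]

variable [Fintype G]

lemma sum_eq_zero_of_odd (hodd : ∀ x, f (-x) = -f x) : ∑ x, f x = 0 := by
  have h : ∑ x, f (-x) = ∑ x, f x := Equiv.sum_comp (Equiv.neg G) f
  simp only [hodd, Finset.sum_neg_distrib] at h
  omega

/-- The positive set of an odd sign function is skew. -/
lemma isSkewSet_filter_eq_one (hodd : ∀ x, f (-x) = -f x)
    (hsign : ∀ x, x ≠ 0 → f x = 1 ∨ f x = -1) :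
    IsSkewSet (Finset.univ.filter fun x => f x = 1) := by
  have hmem : ∀ x, x ∈ (Finset.univ.filter fun x => f x = 1).image (fun x => -x) ↔ f x = -1 := by
    intro x
    simp only [Finset.mem_image, Finset.mem_filter, Finset.mem_univ, true_and]
    constructor
    · rintro ⟨y, hy, rfl⟩
      rw [hodd, hy]
    · intro hx
      exact ⟨-x, by rw [hodd, hx, neg_neg], neg_neg x⟩
  constructor
  · ext x
    rw [Finset.mem_inter, hmem]
    simp only [Finset.mem_filter, Finset.mem_univ, true_and, Finset.notMem_empty, iff_false]
    omega
  · ext x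
    rw [Finset.mem_union, hmem]
    simp only [Finset.mem_filter, Finset.mem_univ, true_and, Finset.mem_sdiff,
      Finset.mem_singleton]
    refine ⟨?_, hsign x⟩
    rintro h rfl
    have h0 := apply_zero_of_odd hodd
    omega

lemma two_mul_card_filter_eq_one (hodd : ∀ x, f (-x) = -f x)
    (hsign : ∀ x, x ≠ 0 → f x = 1 ∨ f x = -1) :
    2 * ((Finset.univ.filter fun x => f x = 1).card : ℤ) = Fintype.card G - 1 := by
  rw [Finset.card_filter]
  push_cast
  rw [Finset.mul_sum]
  simp_rw [two_mul_indicator_eq hodd hsign]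
  rw [Finset.sum_sub_distrib, Finset.sum_add_distrib, sum_eq_zero_of_odd hodd]
  simp

/-- The number of representations of `g` as a difference in the positive set of an odd sign
function, in terms of the autocorrelation of that function. -/
lemma four_mul_card_differences (hodd : ∀ x, f (-x) = -f x)
    (hsign : ∀ x, x ≠ 0 → f x = 1 ∨ f x = -1) {g : G} (hg : g ≠ 0) :
    4 * (((((Finset.univ.filter fun x => f x = 1) ×ˢ (Finset.univ.filter fun x => f x = 1)).filter
      (fun p => p.1 ≠ p.2 ∧ p.1 - p.2 = g)).card : ℕ) : ℤ) =
      ∑ x, f x * f (x + g) + Fintype.card G - 2 := by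
  have hcard : (((Finset.univ.filter fun x => f x = 1) ×ˢ
      (Finset.univ.filter fun x => f x = 1)).filter
      (fun p => p.1 ≠ p.2 ∧ p.1 - p.2 = g)).card =
      (Finset.univ.filter fun x => f x = 1 ∧ f (x + g) = 1).card := by
    refine Finset.card_bij' (fun p _ => p.2) (fun x _ => (x + g, x)) ?_ ?_ ?_ ?_
    · rintro ⟨a, b⟩ h
      simp only [Finset.mem_filter, Finset.mem_product, Finset.mem_univ, true_and] at h ⊢
      obtain ⟨⟨ha, hb⟩, -, hab⟩ := h
      exact ⟨hb, by rwa [← hab, add_sub_cancel]⟩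
    · intro x h
      simp only [Finset.mem_filter, Finset.mem_product, Finset.mem_univ, true_and] at h ⊢
      exact ⟨⟨h.2, h.1⟩, by simpa using hg, by simp⟩
    · rintro ⟨a, b⟩ h
      simp only [Finset.mem_filter] at h
      simp [← h.2.2]
    · intro x _
      rfl
  have hterm : ∀ x, 4 * (if f x = 1 ∧ f (x + g) = 1 then 1 else 0 : ℤ) =
      f x * f (x + g) + f x + f (x + g) + 1 - (if x = 0 then f g + 1 else 0)
        - (if x = -g then f (-g) + 1 else 0) := by
    intro x
    have h1 := two_mul_indicator_eq hodd hsign x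
    have h2 := two_mul_indicator_eq hodd hsign (x + g)
    have h0 := apply_zero_of_odd hodd
    have hprod : (if f x = 1 ∧ f (x + g) = 1 then 1 else 0 : ℤ) =
        (if f x = 1 then 1 else 0) * (if f (x + g) = 1 then 1 else 0) := by
      rw [ite_and]
      split_ifs <;> simp
    rw [hprod, show ∀ a b : ℤ, 4 * (a * b) = (2 * a) * (2 * b) by intros; ring, h1, h2]
    by_cases hx : x = 0
    · subst hx
      have : (0 : G) ≠ -g := by simpa [eq_comm] using hg
      simp [h0, hg, this]
    · by_cases hxg : x = -g
      · subst hxg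
        simp [h0, hg]
      · have : x + g ≠ 0 := fun h => hxg (eq_neg_of_add_eq_zero_left h)
        simp only [hx, hxg, this, if_false]
        ring
  have hshift : ∑ x, f (x + g) = 0 := by
    rw [← sum_eq_zero_of_odd hodd]
    exact Equiv.sum_comp (Equiv.addRight g) f
  rw [hcard, Finset.card_filter]
  push_cast
  rw [Finset.mul_sum]
  simp_rw [hterm]
  simp only [Finset.sum_sub_distrib, Finset.sum_add_distrib, hshift, sum_eq_zero_of_odd hodd,
    Finset.sum_ite_eq', Finset.mem_univ, if_true, hodd, Finset.sum_const, Finset.card_univ,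
    nsmul_eq_mul]
  ring

end OddSignFunction

section QuarticCharacter

variable {F : Type} [Field F] [Fintype F]

lemma sum_mulChar_mul_inv_add {R : Type*} [CommRing R] [IsDomain R] {χ : MulChar F R}
    (hχ : χ ≠ 1) {g : F} (hg : g ≠ 0) : ∑ x, χ x * χ⁻¹ (x + g) = -1 := by
  have hsubst : ∑ x, χ x * χ⁻¹ (x + g) = ∑ y, χ (-g * y) * χ⁻¹ (-g * y + g) :=
    (Equiv.sum_comp (Equiv.mulLeft₀ (-g) (neg_ne_zero.mpr hg))
      (fun x => χ x * χ⁻¹ (x + g))).symm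
  have hg1 : χ g * χ⁻¹ g = 1 := by
    rw [← MulChar.mul_apply, mul_inv_cancel, MulChar.one_apply hg.isUnit]
  have hneg : χ (-1) * χ (-1) = 1 := by rw [← map_mul]; simp
  have hterm : ∀ y, χ (-g * y) * χ⁻¹ (-g * y + g) = χ (-1) * (χ y * χ⁻¹ (1 - y)) := by
    intro y
    rw [show -g * y = (-1) * g * y by ring, show (-1) * g * y + g = g * (1 - y) by ring]
    simp only [map_mul]
    linear_combination χ (-1) * χ y * χ⁻¹ (1 - y) * hg1
  rw [hsubst]
  simp_rw [hterm]
  rw [← Finset.mul_sum, show ∑ y, χ y * χ⁻¹ (1 - y) = jacobiSum χ χ⁻¹ from rfl,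
    jacobiSum_nontrivial_inv hχ]
  linear_combination -hneg

lemma mulChar_neg_one_of_orderOf_eq_four {R : Type*} [CommRing R] [IsDomain R] {χ : MulChar F R}
    (hχ : orderOf χ = 4) (hcard : Fintype.card F % 8 = 5) : χ (-1) = -1 := by
  have hneg : χ (-1) * χ (-1) = 1 := by rw [← map_mul]; simp
  refine (mul_self_eq_one_iff.mp hneg).resolve_left fun h => ?_
  have hchar : ringChar F ≠ 2 := by
    intro h2
    have := FiniteField.even_card_of_char_two h2
    omega
  have hsq : χ ^ 2 = 1 := by
    ext a
    have ha : (a : F) ≠ 0 := a.ne_zero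
    have h4 : χ a ^ 4 = 1 := by
      rw [← MulChar.pow_apply_coe, ← hχ, pow_orderOf_eq_one, MulChar.one_apply_coe]
    have hpow : χ a ^ (Fintype.card F / 2) = 1 := by
      rw [← map_pow]
      rcases FiniteField.pow_dichotomy hchar ha with h1 | h1 <;> rw [h1]
      · simp
      · exact h
    rw [MulChar.pow_apply_coe, MulChar.one_apply_coe]
    rwa [show Fintype.card F / 2 = 4 * (Fintype.card F / 8) + 2 by omega, pow_add, pow_mul, h4,
      one_pow, one_mul] at hpow
  have hdvd := orderOf_dvd_of_pow_eq_one hsq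
  rw [hχ] at hdvd
  omega

lemma GaussianInt.isPrimitiveRoot_I : IsPrimitiveRoot (⟨0, 1⟩ : GaussianInt) 4 := by
  refine (IsPrimitiveRoot.iff (by norm_num)).mpr ⟨by decide, fun l hl hl4 => ?_⟩
  interval_cases l <;> decide

lemma GaussianInt.eq_of_pow_four_eq_one {z : GaussianInt} (hz : z ^ 4 = 1) :
    z = 1 ∨ z = -1 ∨ z = ⟨0, 1⟩ ∨ z = ⟨0, -1⟩ := by
  have h : (z - 1) * ((z + 1) * ((z - ⟨0, 1⟩) * (z - ⟨0, -1⟩))) = 0 := by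
    have hI : (⟨0, -1⟩ : GaussianInt) = -⟨0, 1⟩ := by decide
    have hI2 : (⟨0, 1⟩ : GaussianInt) ^ 2 = -1 := by decide
    rw [hI]
    linear_combination hz - (z ^ 2 - 1) * hI2
  simp only [mul_eq_zero, sub_eq_zero, add_eq_zero_iff_eq_neg] at h
  exact h

lemma exists_quartic_mulChar (hcard : Fintype.card F % 8 = 5) :
    ∃ χ : MulChar F GaussianInt, orderOf χ = 4 :=
  MulChar.exists_mulChar_orderOf F (by omega) GaussianInt.isPrimitiveRoot_I

end QuarticCharacter

/-- (Szekeres) If `q ≡ 5 (mod 8)` is a prime power, then there is a skew Hadamard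
difference family with two blocks in `(F_q, +)`, with parameters
`(q, (q-1)/2, (q-3)/2)`. -/
theorem skew_hadamard_two_blocks (q : ℕ) (hq : IsPrimePow q) (hmod : q % 8 = 5)
    (F : Type) [Field F] [Fintype F] (hF : Fintype.card F = q) :
    ∃ B : Fin 2 → Finset F,
      IsDiffFamily B ((q - 1) / 2) ((q - 3) / 2) ∧ ∀ i, IsSkewSet (B i) := by
  subst hF
  obtain ⟨χ, hχ⟩ := exists_quartic_mulChar (F := F) hmod
  have hχ1 : χ ≠ 1 := by
    rintro rfl
    simp at hχ
  have hneg (x : F) : χ (-x) = -χ x := by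
    rw [neg_eq_neg_one_mul x, map_mul, mulChar_neg_one_of_orderOf_eq_four hχ hmod, neg_one_mul]
  have hval (x : F) (hx : x ≠ 0) : χ x = 1 ∨ χ x = -1 ∨ χ x = ⟨0, 1⟩ ∨ χ x = ⟨0, -1⟩ := by
    apply GaussianInt.eq_of_pow_four_eq_one
    rw [← MulChar.pow_apply' χ (by norm_num), ← hχ, pow_orderOf_eq_one,
      MulChar.one_apply hx.isUnit]
  have hinv (x : F) : χ⁻¹ x = star (χ x) := by
    by_cases hx : x = 0
    · rw [hx, MulChar.map_zero, MulChar.map_zero, star_zero]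
    · have h1 : χ x * χ⁻¹ x = 1 := by
        rw [← MulChar.mul_apply, mul_inv_cancel, MulChar.one_apply (Ne.isUnit hx)]
      have h2 : χ x * star (χ x) = 1 := by
        rcases hval x hx with h | h | h | h <;> rw [h] <;> decide
      exact mul_left_cancel₀ (left_ne_zero_of_mul_eq_one h1) (h1.trans h2.symm)
  let f : Fin 2 → F → ℤ := ![fun x => (χ x).re + (χ x).im, fun x => (χ x).re - (χ x).im]
  have hodd (i : Fin 2) (x : F) : f i (-x) = -f i x := by
    fin_cases i <;> simp [f, hneg] <;> ring
  have hsign (i : Fin 2) (x : F) (hx : x ≠ 0) : f i x = 1 ∨ f i x = -1 := by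
    fin_cases i <;> rcases hval x hx with h | h | h | h <;> simp [f, h]
  have hcorr (g : F) (hg : g ≠ 0) :
      ∑ x, f 0 x * f 0 (x + g) + ∑ x, f 1 x * f 1 (x + g) = -2 := by
    have hre : (∑ x, χ x * χ⁻¹ (x + g)).re = (-1 : GaussianInt).re :=
      congrArg _ (sum_mulChar_mul_inv_add hχ1 hg)
    have hsum : (∑ x, χ x * χ⁻¹ (x + g)).re = ∑ x, (χ x * χ⁻¹ (x + g)).re :=
      map_sum (AddMonoidHom.mk' (fun z : GaussianInt => z.re) fun _ _ => rfl) _ _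
    rw [hsum] at hre
    simp only [hinv] at hre
    have hterm (x : F) : f 0 x * f 0 (x + g) + f 1 x * f 1 (x + g) =
        2 * (χ x * star (χ (x + g))).re := by
      simp [f]
      ring
    rw [← Finset.sum_add_distrib]
    simp_rw [hterm]
    rw [← Finset.mul_sum, hre]
    rfl
  refine ⟨fun i => Finset.univ.filter fun x => f i x = 1, ⟨fun i => ?_, fun g hg => ?_⟩,
    fun i => isSkewSet_filter_eq_one (hodd i) (hsign i)⟩
  · have h := two_mul_card_filter_eq_one (hodd i) (hsign i)
    dsimp only
    omega
  · have h0 := four_mul_card_differences (hodd 0) (hsign 0) hg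
    have h1 := four_mul_card_differences (hodd 1) (hsign 1) hg
    have h2 := hcorr g hg
    rw [Fin.sum_univ_two]
    dsimp only
    omega
end

section
/- Let q = p^e where p is a prime with p ≡ 5 (mod 8) and e is a positive integer with e ≡ 2 (mod 4). Then there exists a skew Hadamard difference family with two blocks in (F_q,+), i.e., two skew subsets of F_q of size (q−1)/2 forming a difference family with parameters (q, (q−1)/2, (q−3)/2). -/
open Finset
open scoped Classical

section SignFunction

variable {G : Type}

/-- The block on which a sign function takes the value `1`. -/
noncomputable def positiveBlock [Fintype G] (σ : G → ℤ) : Finset G :=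
  Finset.univ.filter fun x => σ x = 1

variable [AddCommGroup G]

/-- An odd function with values `±1` away from `0`. -/
structure IsSignFunction (σ : G → ℤ) : Prop where
  odd : ∀ x, σ (-x) = -σ x
  eq_or : ∀ x, x ≠ 0 → σ x = 1 ∨ σ x = -1

namespace IsSignFunction

variable {σ : G → ℤ}

lemma map_zero (h : IsSignFunction σ) : σ 0 = 0 := by
  have := h.odd 0
  rw [neg_zero] at this
  omega

lemma two_mul_indicator (h : IsSignFunction σ) (x : G) :
    2 * (if σ x = 1 then 1 else 0 : ℤ) = σ x + 1 - if x = 0 then 1 else 0 := by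
  by_cases hx : x = 0
  · simp [hx, h.map_zero]
  · rcases h.eq_or x hx with h' | h' <;> simp [hx, h']

variable [Fintype G]

lemma isSkewSet (h : IsSignFunction σ) : IsSkewSet (positiveBlock σ) := by
  constructor
  · ext x
    simp only [positiveBlock, mem_inter, mem_filter, mem_univ, true_and, mem_image,
      notMem_empty, iff_false, not_and, not_exists]
    rintro hx y hy rfl
    rw [h.odd] at hx
    omega
  · ext x
    simp only [positiveBlock, mem_union, mem_filter, mem_univ, true_and, mem_image, mem_sdiff,
      mem_singleton]
    constructor
    · rintro (hx | ⟨y, hy, rfl⟩) h0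
      · rw [h0, h.map_zero] at hx
        omega
      · rw [neg_eq_zero.1 h0, h.map_zero] at hy
        omega
    · intro hx
      refine (h.eq_or x hx).imp id fun hx' => ⟨-x, ?_, neg_neg x⟩
      rw [h.odd]
      omega

lemma sum_eq_zero (h : IsSignFunction σ) : ∑ x, σ x = 0 := by
  have := Equiv.sum_comp (Equiv.neg G) σ
  simp only [Equiv.neg_apply, h.odd, sum_neg_distrib] at this
  omega

lemma two_mul_card (h : IsSignFunction σ) :
    2 * ((positiveBlock σ).card : ℤ) = Fintype.card G - 1 := by
  rw [positiveBlock, card_filter]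
  push_cast
  rw [mul_sum, sum_congr rfl fun x _ => h.two_mul_indicator x]
  simp [sum_sub_distrib, sum_add_distrib, h.sum_eq_zero]

lemma four_mul_card_differences (h : IsSignFunction σ) {g : G} (hg : g ≠ 0) :
    4 * ((((positiveBlock σ) ×ˢ (positiveBlock σ)).filter
      (fun p => p.1 ≠ p.2 ∧ p.1 - p.2 = g)).card : ℤ) =
      ∑ x, σ x * σ (x + g) + Fintype.card G - 2 := by
  have hcard : (((positiveBlock σ) ×ˢ (positiveBlock σ)).filter
      (fun p => p.1 ≠ p.2 ∧ p.1 - p.2 = g)).card =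
      (univ.filter fun x => σ x = 1 ∧ σ (x + g) = 1).card := by
    refine card_bij' (fun p _ => p.2) (fun x _ => (x + g, x)) ?_ ?_ ?_ ?_
    · rintro ⟨a, b⟩ hp
      simp only [positiveBlock, mem_filter, mem_product, mem_univ, true_and] at hp ⊢
      obtain ⟨⟨ha, hb⟩, -, rfl⟩ := hp
      simpa [hb] using ha
    · intro x hx
      simp only [positiveBlock, mem_filter, mem_product, mem_univ, true_and] at hx ⊢
      simpa [hg] using hx.symm
    · rintro ⟨a, b⟩ hp
      simp only [mem_filter] at hp
      simp [← hp.2.2]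
    · simp
  have hpt : ∀ x, 4 * (if σ x = 1 ∧ σ (x + g) = 1 then 1 else 0 : ℤ) =
      σ x * σ (x + g) + σ x + σ (x + g) + 1 - (if x = 0 then σ g + 1 else 0)
        - (if x = -g then σ (-g) + 1 else 0) := by
    intro x
    have h1 := h.two_mul_indicator x
    have h2 := h.two_mul_indicator (x + g)
    have h3 : (if σ x = 1 ∧ σ (x + g) = 1 then 1 else 0 : ℤ) =
        (if σ x = 1 then 1 else 0) * (if σ (x + g) = 1 then 1 else 0) := by
      rw [ite_and]
      split_ifs <;> rfl
    rw [h3, show ∀ a b : ℤ, 4 * (a * b) = (2 * a) * (2 * b) from fun a b => by ring, h1, h2]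
    by_cases hx : x = 0
    · simp [hx, hg, eq_comm (a := (0 : G)), h.map_zero]
    · by_cases hx' : x = -g
      · simp [hx', hg, h.map_zero]
      · have : x + g ≠ 0 := fun h0 => hx' (eq_neg_of_add_eq_zero_left h0)
        simp only [hx, hx', this, if_false]
        ring
  have hshift : ∑ x, σ (x + g) = 0 := by
    rw [← h.sum_eq_zero]
    exact Equiv.sum_comp (Equiv.addRight g) σ
  rw [hcard, card_filter]
  push_cast
  rw [mul_sum, sum_congr rfl fun x _ => hpt x]
  simp only [sum_sub_distrib, sum_add_distrib, h.sum_eq_zero, hshift, sum_ite_eq', mem_univ,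
    if_true, h.odd]
  simp
  ring

end IsSignFunction

lemma isDiffFamily_positiveBlock [Fintype G] {σ τ : G → ℤ} (hσ : IsSignFunction σ) (hτ : IsSignFunction τ)
    (h : ∀ g, g ≠ 0 → ∑ x, σ x * σ (x + g) + ∑ x, τ x * τ (x + g) = -2) :
    IsDiffFamily ![positiveBlock σ, positiveBlock τ]
      ((Fintype.card G - 1) / 2) ((Fintype.card G - 3) / 2) := by
  have h1 := hσ.two_mul_card
  have h2 := hτ.two_mul_card
  refine ⟨fun i => ?_, fun g hg => ?_⟩
  · fin_cases i
    · change (positiveBlock σ).card = _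
      omega
    · change (positiveBlock τ).card = _
      omega
  · have h3 := hσ.four_mul_card_differences hg
    have h4 := hτ.four_mul_card_differences hg
    have h5 := h g hg
    rw [Fin.sum_univ_two]
    simp only [Matrix.cons_val_zero, Matrix.cons_val_one]
    omega

end SignFunction

section OctavicLog

/-- The sign on `ZMod 8` that is positive on `0, 1, 2, 3`. -/
def octantSign (a : ZMod 8) : ℤ := if a.val < 4 then 1 else -1

/-- The indicator of `0` minus the indicator of `4` on `ZMod 8`. -/
def antipodalSign (a : ZMod 8) : ℤ := if a = 0 then 1 else if a = 4 then -1 else 0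

lemma octantSign_identity : ∀ a b : ZMod 8,
    octantSign a * octantSign b + octantSign (2 + a) * octantSign (2 + b) +
      (octantSign (5 * a) * octantSign (5 * b) +
        octantSign (5 * (2 + a)) * octantSign (5 * (2 + b))) = 4 * antipodalSign (b - a) := by
  decide

variable {F : Type} [Field F]

/-- A logarithm modulo `8` on the nonzero elements of a field, with `-1` in the class of `4`. -/
structure IsOctavicLog (l : F → ZMod 8) : Prop where
  map_mul : ∀ x y, x ≠ 0 → y ≠ 0 → l (x * y) = l x + l y
  map_neg_one : l (-1) = 4

/-- A function on `ZMod 8` composed with a logarithm, extended by zero. -/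
noncomputable def logLift (l : F → ZMod 8) (ε : ZMod 8 → ℤ) (x : F) : ℤ :=
  if x = 0 then 0 else ε (l x)

lemma exists_isOctavicLog [Fintype F] (h : Fintype.card F % 16 = 9) :
    ∃ l : F → ZMod 8, IsOctavicLog l ∧ ∃ w, w ≠ 0 ∧ l w = 2 := by
  have hn : Nat.card Fˣ = Fintype.card F - 1 := by
    rw [Nat.card_eq_fintype_card, Fintype.card_units]
  have hne : Nat.card Fˣ ≠ 0 := by omega
  have : NeZero (Nat.card Fˣ) := ⟨hne⟩
  have hdvd : 8 ∣ Nat.card Fˣ := by omega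
  let E : Multiplicative (ZMod (Nat.card Fˣ)) ≃* Fˣ := zmodCyclicMulEquiv inferInstance
  let c : ZMod (Nat.card Fˣ) →+* ZMod 8 := ZMod.castHom hdvd (ZMod 8)
  let L : Fˣ → ZMod 8 := fun u => c (E.symm u).toAdd
  have hL : ∀ u v, L (u * v) = L u + L v := fun u v => by
    simp only [L, _root_.map_mul, toAdd_mul, map_add]
  have hchar : (-1 : Fˣ) ≠ 1 := by
    intro h1
    have h2 : (-1 : F) = 1 := by simpa using congrArg Units.val h1
    have h3 : ringChar F = 2 := by
      by_contra h4
      exact Ring.neg_one_ne_one_of_char_ne_two h4 h2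
    have := FiniteField.even_card_iff_char_two.1 h3
    omega
  have hneg : L (-1) = 4 := by
    set m : ZMod (Nat.card Fˣ) := (E.symm (-1)).toAdd with hm
    have h0 : m ≠ 0 := by
      intro h0
      apply hchar
      have : E.symm (-1) = 1 := h0
      simpa using this
    have h2 : m + m = 0 := by
      rw [hm, ← toAdd_mul, ← _root_.map_mul]
      simp
    have h3 : (m.val : ZMod (Nat.card Fˣ)) = m := ZMod.natCast_zmod_val m
    have h4 : Nat.card Fˣ ∣ m.val + m.val := by
      rw [← ZMod.natCast_eq_zero_iff]
      push_cast
      rw [h3, h2]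
    have h5 := ZMod.val_lt m
    have h6 : m.val ≠ 0 := by simpa using h0
    have h7 : m.val + m.val = Nat.card Fˣ := by
      obtain ⟨k, hk⟩ := h4
      have : k = 1 := by
        have h8 : k < 2 := by
          by_contra h9
          have : Nat.card Fˣ * 2 ≤ Nat.card Fˣ * k := Nat.mul_le_mul_left _ (by omega)
          omega
        have h10 : k ≠ 0 := by
          rintro rfl
          omega
        omega
      rw [hk, this, mul_one]
    have h8 : m.val % 8 = 4 := by omega
    change c m = 4
    rw [← h3, map_natCast, ← ZMod.natCast_mod, h8]
    rfl
  refine ⟨fun x => if hx : x = 0 then 0 else L (Units.mk0 x hx), ⟨fun x y hx hy => ?_, ?_⟩,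
    (E (Multiplicative.ofAdd 2) : Fˣ), Units.ne_zero _, ?_⟩
  · simp only [hx, hy, mul_eq_zero, or_self, dite_false]
    rw [Units.mk0_mul, hL]
  · have : Units.mk0 (-1 : F) (neg_ne_zero.2 one_ne_zero) = -1 := by ext; simp
    simp only [neg_eq_zero, one_ne_zero, dite_false]
    rw [this, hneg]
  · simp only [Units.ne_zero, dite_false, Units.mk0_val, L, MulEquiv.symm_apply_apply,
      toAdd_ofAdd]
    exact map_ofNat c 2

namespace IsOctavicLog

variable {l : F → ZMod 8}

lemma map_one (h : IsOctavicLog l) : l 1 = 0 := by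
  simpa using h.map_mul 1 1 one_ne_zero one_ne_zero

lemma map_neg (h : IsOctavicLog l) {x : F} (hx : x ≠ 0) : l (-x) = 4 + l x := by
  rw [← neg_one_mul, h.map_mul _ _ (neg_ne_zero.2 one_ne_zero) hx, h.map_neg_one]

lemma map_pow (h : IsOctavicLog l) {x : F} (hx : x ≠ 0) (n : ℕ) : l (x ^ n) = n * l x := by
  induction n with
  | zero => simp [h.map_one]
  | succ n ih =>
    rw [pow_succ, h.map_mul _ _ (pow_ne_zero n hx) hx, ih]
    push_cast
    ring

lemma logLift_neg (h : IsOctavicLog l) {ε : ZMod 8 → ℤ} (hε : ∀ a, ε (4 + a) = -ε a) (x : F) :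
    logLift l ε (-x) = -logLift l ε x := by
  by_cases hx : x = 0
  · simp [logLift, hx]
  · simp [logLift, hx, h.map_neg hx, hε]

lemma isSignFunction (h : IsOctavicLog l) {w : F} (hw : w ≠ 0) :
    IsSignFunction fun x => logLift l octantSign (w * x) where
  odd x := by
    rw [mul_neg]
    exact h.logLift_neg (by decide) _
  eq_or x hx := by
    have : ∀ a, octantSign a = 1 ∨ octantSign a = -1 := by decide
    simpa [logLift, hx, hw] using this _

variable [Fintype F]

/-- The autocorrelation of the octant sign function. -/
noncomputable def autocorr (l : F → ZMod 8) (g : F) : ℤ :=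
  ∑ x, logLift l octantSign x * logLift l octantSign (x + g)

lemma autocorr_mul (l : F → ZMod 8) {w : F} (hw : w ≠ 0) (g : F) :
    autocorr l (w * g) =
      ∑ x, logLift l octantSign (w * x) * logLift l octantSign (w * (x + g)) := by
  rw [autocorr, ← Equiv.sum_comp (Equiv.mulLeft₀ w hw)]
  simp [mul_add]

lemma autocorr_mul_eq (h : IsOctavicLog l) {c : F} (hc : c ≠ 0) (hl : l c = 0 ∨ l c = 4) (g : F) :
    autocorr l (c * g) = autocorr l g := by
  have h4 : ∀ a, octantSign (4 + a) = -octantSign a := by decide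
  rw [autocorr_mul l hc, autocorr]
  refine sum_congr rfl fun x _ => ?_
  rcases hl with hl | hl
  · have : ∀ y, logLift l octantSign (c * y) = logLift l octantSign y := fun y => by
      by_cases hy : y = 0
      · simp [hy]
      · simp [logLift, hy, hc, h.map_mul c y hc hy, hl]
    rw [this, this]
  · have : ∀ y, logLift l octantSign (c * y) = -logLift l octantSign y := fun y => by
      by_cases hy : y = 0
      · simp [logLift, hy]
      · simp [logLift, hy, hc, h.map_mul c y hc hy, hl, h4]
    rw [this, this, neg_mul_neg]

lemma autocorr_eq_frobenius (h : IsOctavicLog l) {p : ℕ} [Fact p.Prime] [CharP F p]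
    (hp : p % 8 = 5) {g : F} (hg : g ≠ 0) :
    autocorr l g = ∑ x, logLift l (fun a => octantSign (5 * a)) x *
      logLift l (fun a => octantSign (5 * a)) (x + g) := by
  have hp0 : p ≠ 0 := by omega
  have h5 : (p : ZMod 8) = 5 := by
    rw [← ZMod.natCast_mod, hp]
    rfl
  have hpow : autocorr l (g ^ p) = autocorr l g := by
    have hsplit : g ^ p = g ^ (p - 1) * g := by
      rw [← pow_succ]
      congr 1
      omega
    rw [hsplit]
    refine h.autocorr_mul_eq (pow_ne_zero _ hg) ?_ g
    rw [h.map_pow hg, Nat.cast_sub (by omega), h5]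
    generalize l g = a
    revert a
    decide
  have hbij : Function.Bijective (frobenius F p) :=
    Finite.injective_iff_bijective.1 (frobenius_inj F p)
  rw [← hpow, autocorr, ← hbij.sum_comp]
  have hlift : ∀ y : F, logLift l octantSign (y ^ p) =
      logLift l (fun a => octantSign (5 * a)) y := fun y => by
    by_cases hy : y = 0
    · simp [logLift, hy, hp0]
    · simp [logLift, hy, h.map_pow hy, h5]
  refine sum_congr rfl fun x _ => ?_
  rw [← hlift, ← hlift, add_pow_char, frobenius_def]

lemma sum_antipodalSign (h : IsOctavicLog l) {g : F} (hg : g ≠ 0) :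
    ∑ x : F, (if x = 0 then 0 else logLift l antipodalSign (1 + g * x⁻¹)) = -1 := by
  have hzero : ∑ y : F, logLift l antipodalSign y = 0 := by
    have := Equiv.sum_comp (Equiv.neg F) (logLift l antipodalSign)
    simp only [Equiv.neg_apply, h.logLift_neg (ε := antipodalSign) (by decide),
      sum_neg_distrib] at this
    omega
  have hre : ∑ x : F, logLift l antipodalSign (1 + g * x⁻¹) = 0 := by
    rw [← hzero]
    exact Equiv.sum_comp (((Equiv.inv F).trans (Equiv.mulLeft₀ g hg)).trans (Equiv.addLeft 1))
      (logLift l antipodalSign)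
  have hpt : ∀ x : F, (if x = 0 then 0 else logLift l antipodalSign (1 + g * x⁻¹)) =
      logLift l antipodalSign (1 + g * x⁻¹) - if x = 0 then 1 else 0 := fun x => by
    by_cases hx : x = 0
    · simp [hx, logLift, h.map_one, antipodalSign]
    · simp [hx]
  rw [sum_congr rfl fun x _ => hpt x, sum_sub_distrib, hre]
  simp

lemma autocorr_add (h : IsOctavicLog l) {p : ℕ} [Fact p.Prime] [CharP F p]
    (hp : p % 8 = 5) {w g : F} (hw : w ≠ 0) (hlw : l w = 2) (hg : g ≠ 0) :
    autocorr l g + autocorr l (w * g) = -2 := by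
  have h1 := h.autocorr_eq_frobenius hp hg
  have h2 := h.autocorr_eq_frobenius hp (mul_ne_zero hw hg)
  rw [← Equiv.sum_comp (Equiv.mulLeft₀ w hw)] at h2
  change _ = ∑ x, logLift l _ (w * x) * logLift l _ (w * x + w * g) at h2
  simp only [← mul_add] at h2
  have key : 2 * (autocorr l g + autocorr l (w * g)) = 4 * -1 := by
    calc _ = (autocorr l g + autocorr l (w * g)) + (autocorr l g + autocorr l (w * g)) :=
          two_mul _
      _ = _ := by
        conv_lhs =>
          arg 2
          rw [h1, h2]
        rw [autocorr_mul l hw, autocorr, ← h.sum_antipodalSign hg, mul_sum,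
          ← sum_add_distrib, ← sum_add_distrib, ← sum_add_distrib]
        refine sum_congr rfl fun x _ => ?_
        by_cases hx : x = 0
        · simp [hx, logLift]
        rw [show 1 + g * x⁻¹ = (x + g) / x by field_simp]
        by_cases hxg : x + g = 0
        · simp [hxg, logLift]
        have hy : (x + g) / x ≠ 0 := div_ne_zero hxg hx
        have hdiv : l ((x + g) / x) = l (x + g) - l x := by
          rw [eq_sub_iff_add_eq, ← h.map_mul _ _ hy hx, div_mul_cancel₀ _ hx]
        simp only [logLift, hx, hxg, hy, hw, mul_eq_zero, or_self, if_false,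
          h.map_mul _ _ hw hx, h.map_mul _ _ hw hxg, hlw, hdiv]
        exact octantSign_identity _ _
  omega

end IsOctavicLog

end OctavicLog

/-- (Szekeres, Whiteman) If `q = p^e` with `p ≡ 5 (mod 8)` prime and
`e ≡ 2 (mod 4)`, then there is a skew Hadamard difference family with two blocks
in `(F_q, +)`, with parameters `(q, (q-1)/2, (q-3)/2)`. -/
theorem skew_hadamard_two_blocks_lifted (p e : ℕ) (hp : p.Prime) (hpmod : p % 8 = 5)
    (he : e % 4 = 2)
    (F : Type) [Field F] [Fintype F] (hF : Fintype.card F = p ^ e) :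
    ∃ B : Fin 2 → Finset F,
      IsDiffFamily B ((p ^ e - 1) / 2) ((p ^ e - 3) / 2) ∧ ∀ i, IsSkewSet (B i) := by
  have : Fact p.Prime := ⟨hp⟩
  have : CharP F p := charP_of_card_eq_prime_pow hF
  have hmod : Fintype.card F % 16 = 9 := by
    obtain ⟨k, rfl⟩ : ∃ k, e = 4 * k + 2 := ⟨e / 4, by omega⟩
    have h16 : p % 16 = 5 ∨ p % 16 = 13 := by omega
    rw [hF, pow_add, pow_mul, Nat.mul_mod, Nat.pow_mod (p ^ 4), Nat.pow_mod p 4, Nat.pow_mod p 2]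
    rcases h16 with h | h <;> simp [h]
  obtain ⟨l, hl, w, hw, hlw⟩ := exists_isOctavicLog hmod
  have hσ : IsSignFunction (logLift l octantSign) := by
    simpa using hl.isSignFunction one_ne_zero
  have hτ := hl.isSignFunction hw
  refine ⟨![positiveBlock (logLift l octantSign),
    positiveBlock fun x => logLift l octantSign (w * x)], ?_, ?_⟩
  · rw [← hF]
    refine isDiffFamily_positiveBlock hσ hτ fun g hg => ?_
    have := hl.autocorr_add hpmod hw hlw hg
    rwa [IsOctavicLog.autocorr_mul l hw] at this
  · intro i
    fin_cases i
    · exact hσ.isSkewSet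
    · exact hτ.isSkewSet
end

section
/- Let q be a prime power with q ≡ 9 (mod 16) and let e be an arbitrary positive integer. Then there exists a skew Hadamard matrix of order 4(q^e + 1). -/
open Matrix

/-- `q ^ 2 ^ i - 1` is exactly divisible by `2 ^ (i + 3)` when `q ≡ 9 (mod 16)`. -/
lemma pow_two_pow_eq_one_add_odd_mul {q : ℕ} (hq : q % 16 = 9) (i : ℕ) :
    ∃ w, Odd w ∧ q ^ 2 ^ i = 1 + 2 ^ (i + 3) * w := by
  induction i with
  | zero => exact ⟨q / 8, by rw [Nat.odd_iff]; omega, by simp; omega⟩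
  | succ i ih =>
    obtain ⟨w, hw, h⟩ := ih
    refine ⟨w + 2 ^ (i + 2) * w ^ 2, hw.add_even ?_, ?_⟩
    · exact (Nat.even_pow.2 ⟨even_two, by omega⟩).mul_right _
    · rw [pow_succ, pow_mul, h]; ring

/-- A finite field has a primitive complex additive character invariant under Frobenius. -/
lemma exists_primitive_addChar_frobenius_invariant (F : Type*) [Field F] [Fintype F]
    (p : ℕ) [Fact p.Prime] [CharP F p] :
    ∃ ψ : AddChar F ℂ, ψ.IsPrimitive ∧ ∀ x, ψ (x ^ p) = ψ x := by
  let _ : Algebra (ZMod p) F := ZMod.algebra _ _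
  let ψ : AddChar F ℂ :=
    (ZMod.stdAddChar (N := p)).compAddMonoidHom (Algebra.trace (ZMod p) F).toAddMonoidHom
  refine ⟨ψ, AddChar.IsPrimitive.of_ne_one (AddChar.ne_one_iff.2 ?_), fun x => ?_⟩
  · have hp : ringChar F = p := ringChar.eq F p
    subst hp
    obtain ⟨a, ha⟩ := FiniteField.trace_to_zmod_nondegenerate F one_ne_zero
    rw [one_mul] at ha
    refine ⟨a, fun h => ha (ZMod.injective_stdAddChar ?_)⟩
    rw [AddChar.map_zero_eq_one]
    exact h
  · have := Algebra.trace_eq_of_algEquiv (FiniteField.frobeniusAlgEquiv (ZMod p) F p) x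
    have h2 : FiniteField.frobeniusAlgEquiv (ZMod p) F p x = x ^ p := by simp
    rw [h2] at this
    exact congrArg (ZMod.stdAddChar (N := p)) this

section CharacterSums

variable {F : Type*} [Field F] [Fintype F]

/-- The terms outside the eighth roots of unity cancel in orbits of powers of Frobenius. -/
lemma sum_eq_zero_of_frobenius_invariant (p : ℕ) [Fact p.Prime] [CharP F p]
    {a m n : ℕ} (ha : p ^ a % 16 = 9)
    (hF : ∀ x : F, x ≠ 0 → (x ^ m) ^ 2 ^ n = 1) {ψ : F → ℂ}
    (hψ : ∀ x, ψ (x ^ p) = ψ x) {s : F → ℂ} (hs : ∀ z, s (-z) = -s z)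
    (hs8 : ∀ z, z ^ 8 = 1 → s z = 0) : ∑ x, s (x ^ m) * ψ x = 0 := by
  classical
  have layer (j : ℕ) :
      ∑ x, (if (x ^ m) ^ 2 ^ (j + 4) = 1 ∧ (x ^ m) ^ 2 ^ (j + 3) ≠ 1
        then s (x ^ m) * ψ x else 0) = 0 := by
    obtain ⟨w, hw, hq⟩ := pow_two_pow_eq_one_add_odd_mul ha j
    have hfrob (x : F) : iterateFrobenius F p (a * 2 ^ j) x = x * (x ^ 2 ^ (j + 3)) ^ w := by
      rw [iterateFrobenius_def, pow_mul, hq, pow_add, pow_one, pow_mul]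
    have hψ' (k : ℕ) (x : F) : ψ (iterateFrobenius F p k x) = ψ x := by
      induction k with
      | zero => simp
      | succ k ih => rw [iterateFrobenius_def, pow_succ, pow_mul, hψ, ← iterateFrobenius_def, ih]
    have hbij : Function.Bijective (iterateFrobenius F p (a * 2 ^ j)) :=
      Finite.injective_iff_bijective.1 (iterateFrobenius F p (a * 2 ^ j)).injective
    rw [← self_eq_neg, ← Finset.sum_neg_distrib]
    conv_lhs => rw [← hbij.sum_comp]
    refine Finset.sum_congr rfl fun x _ => ?_
    have hiff (k : ℕ) :
        (iterateFrobenius F p (a * 2 ^ j) x ^ m) ^ k = 1 ↔ (x ^ m) ^ k = 1 := by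
      rw [← map_pow, ← map_pow, map_eq_one_iff _ hbij.1]
    simp only [hiff, ne_eq]
    split_ifs with h
    · have hneg : (x ^ m) ^ 2 ^ (j + 3) = -1 := by
        refine (sq_eq_one_iff.1 ?_).resolve_left h.2
        rw [← pow_mul, ← pow_succ]
        exact h.1
      have hpow : (x * (x ^ 2 ^ (j + 3)) ^ w) ^ m = -x ^ m := by
        rw [mul_pow, pow_right_comm _ w m, pow_right_comm x _ m, hneg, hw.neg_one_pow,
          mul_neg_one]
      rw [hψ', hfrob, hpow, hs, neg_mul]
    · simp
  have partial_sum (j : ℕ) :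
      ∑ x, (if (x ^ m) ^ 2 ^ (j + 3) = 1 then s (x ^ m) * ψ x else 0) = 0 := by
    induction j with
    | zero =>
      refine Finset.sum_eq_zero fun x _ => ?_
      split_ifs with h
      · rw [hs8 _ (by simpa using h), zero_mul]
      · rfl
    | succ j ih =>
      rw [← add_zero (0 : ℂ)]
      conv_rhs => lhs; rw [← ih]
      conv_rhs => rhs; rw [← layer j]
      rw [← Finset.sum_add_distrib]
      refine Finset.sum_congr rfl fun x _ => ?_
      by_cases h : (x ^ m) ^ 2 ^ (j + 3) = 1
      · have : (x ^ m) ^ 2 ^ (j + 1 + 3) = 1 := by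
          rw [show j + 1 + 3 = j + 3 + 1 by ring, pow_succ, pow_mul, h, one_pow]
        simp only [h, this, if_true, not_true, and_false, if_false, add_zero, ne_eq]
      · simp [h, show j + 1 + 3 = j + 4 by ring]
  rw [← partial_sum n]
  refine Finset.sum_congr rfl fun x _ => ?_
  split_ifs with h
  · rfl
  · have hx : x = 0 := by
      by_contra hx
      exact h (by rw [pow_add, pow_mul, hF x hx, one_pow])
    subst hx
    rcases eq_or_ne m 0 with rfl | hm
    · simp at h
    · have : s 0 = 0 := self_eq_neg.1 (by simpa using hs 0)
      rw [zero_pow hm, this, zero_mul]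

/-- The additive Fourier transform at `y` of the function `x ↦ s (x ^ m)`. -/
noncomputable def charSum (ψ : AddChar F ℂ) (m : ℕ) (s : F → ℂ) (y : F) : ℂ :=
  ∑ x, s (x ^ m) * ψ (x * y)

/-- The transform at `1` kills odd functions vanishing on the eighth roots of unity. -/
def KillsOffEighthRoots (ψ : AddChar F ℂ) (m : ℕ) : Prop :=
  ∀ s : F → ℂ, (∀ z, s (-z) = -s z) → (∀ z, z ^ 8 = 1 → s z = 0) → charSum ψ m s 1 = 0

lemma charSum_mul {ψ : AddChar F ℂ} {m : ℕ} (s : F → ℂ) (l : F) {y : F} (hy : y ≠ 0) :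
    charSum ψ m s (l * y) = charSum ψ m (fun z => s (z / y ^ m)) l := by
  unfold charSum
  rw [← Equiv.sum_comp (Equiv.mulRight₀ y hy) fun x => s (x ^ m / y ^ m) * ψ (x * l)]
  refine Finset.sum_congr rfl fun x _ => ?_
  rw [Equiv.mulRight₀_apply, mul_pow, mul_div_cancel_right₀ _ (pow_ne_zero m hy)]
  ring_nf

lemma charSum_add (ψ : AddChar F ℂ) (m : ℕ) (s t : F → ℂ) (y : F) :
    charSum ψ m (s + t) y = charSum ψ m s y + charSum ψ m t y := by
  simp [charSum, add_mul, Finset.sum_add_distrib]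

lemma charSum_neg {ψ : AddChar F ℂ} {m : ℕ} (hm : Odd m) {s : F → ℂ}
    (hs : ∀ z, s (-z) = -s z) (y : F) : charSum ψ m s (-y) = -charSum ψ m s y := by
  unfold charSum
  rw [← Equiv.sum_comp (Equiv.neg F), ← Finset.sum_neg_distrib]
  refine Finset.sum_congr rfl fun x _ => ?_
  rw [Equiv.neg_apply, hm.neg_pow, hs, neg_mul_neg, neg_mul]

lemma charSum_zero {ψ : AddChar F ℂ} {m : ℕ} (hm : Odd m) {s : F → ℂ}
    (hs : ∀ z, s (-z) = -s z) : charSum ψ m s 0 = 0 :=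
  self_eq_neg.1 (by simpa using charSum_neg (ψ := ψ) hm hs 0)

lemma KillsOffEighthRoots.charSum_eq_zero {ψ : AddChar F ℂ} {m : ℕ}
    (H : KillsOffEighthRoots ψ m) {s : F → ℂ} (hs : ∀ z, s (-z) = -s z) {y : F} (hy : y ≠ 0)
    (h8 : ∀ z, (z * y ^ m) ^ 8 = 1 → s z = 0) : charSum ψ m s y = 0 := by
  rw [← one_mul y, charSum_mul s 1 hy]
  refine H _ (fun z => by rw [neg_div, hs]) fun z hz => h8 _ ?_
  rw [div_mul_cancel₀ _ (pow_ne_zero m hy), hz]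

lemma sum_charSum_sq {ψ : AddChar F ℂ} (hψ : ψ.IsPrimitive) {m : ℕ} (hm : Odd m) {s : F → ℂ}
    (hs : ∀ z, s (-z) = -s z) :
    ∑ y, charSum ψ m s y ^ 2 = -(Fintype.card F * ∑ x, s (x ^ m) ^ 2) := by
  classical
  have expand (y : F) : charSum ψ m s y ^ 2 =
      ∑ x, ∑ x', s (x ^ m) * s (x' ^ m) * ψ (y * (x + x')) := by
    rw [sq, charSum, Finset.sum_mul_sum]
    refine Finset.sum_congr rfl fun x _ => Finset.sum_congr rfl fun x' _ => ?_
    rw [mul_add, AddChar.map_add_eq_mul, mul_comm y x, mul_comm y x']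
    ring
  simp_rw [expand]
  rw [Finset.sum_comm, Finset.mul_sum, ← Finset.sum_neg_distrib]
  refine Finset.sum_congr rfl fun x _ => ?_
  rw [Finset.sum_comm]
  simp_rw [← Finset.mul_sum,
      AddChar.sum_mulShift _ hψ]
  rw [Finset.sum_eq_single (-x)]
  · rw [hm.neg_pow, hs]
    simp
    ring
  · intro b _ hb
    rw [if_neg fun h => hb (eq_neg_of_add_eq_zero_right h)]
    simp
  · simp

lemma KillsOffEighthRoots.sum_charSum_sq_mul [DecidableEq F] {ψ : AddChar F ℂ} {m : ℕ}
    (H : KillsOffEighthRoots ψ m) (hψ : ψ.IsPrimitive) (hm : Odd m) {s : F → ℂ}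
    (hs : ∀ z, s (-z) = -s z) (hs1 : ∀ z, z ≠ 0 → s z ^ 2 = 1) {y : F} (hy : y ≠ 0) :
    ∑ l, (if (l ^ m) ^ 8 = 1 then charSum ψ m s (l * y) ^ 2 else 0) =
      -(Fintype.card F * ∑ l : F, (if (l ^ m) ^ 8 = 1 then 1 else 0)) := by
  have hym : y ^ m ≠ 0 := pow_ne_zero m hy
  have h8neg (z : F) : (-z) ^ 8 = z ^ 8 := (by decide : Even 8).neg_pow z
  set t : F → ℂ := fun z => if z ^ 8 = 1 then s (z / y ^ m) else 0 with ht
  set t' : F → ℂ := fun z => if z ^ 8 = 1 then 0 else s (z / y ^ m) with ht'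
  have hto (z : F) : t (-z) = -t z := by
    simp only [ht, h8neg, neg_div, hs]; split_ifs <;> simp
  have hto' (z : F) : t' (-z) = -t' z := by
    simp only [ht', h8neg, neg_div, hs]; split_ifs <;> simp
  have htt : (fun z => s (z / y ^ m)) = t + t' := by
    funext z; simp only [ht, ht', Pi.add_apply]; split_ifs <;> simp
  have hsum (l : F) : (if (l ^ m) ^ 8 = 1 then charSum ψ m s (l * y) ^ 2 else 0) =
      charSum ψ m t l ^ 2 := by
    rcases eq_or_ne l 0 with rfl | hl
    · simp [charSum_zero hm hto, charSum_zero hm hs]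
    split_ifs with h
    · rw [charSum_mul s l hy, htt, charSum_add, H.charSum_eq_zero hto' hl, add_zero]
      intro z hz
      rw [mul_pow, h, mul_one] at hz
      simp [ht', hz]
    · rw [H.charSum_eq_zero hto hl, zero_pow two_ne_zero]
      intro z hz
      refine if_neg fun hz8 => h ?_
      rwa [mul_pow, hz8, one_mul] at hz
  simp_rw [hsum]
  rw [sum_charSum_sq hψ hm hto]
  congr 2
  refine Finset.sum_congr rfl fun x _ => ?_
  simp only [ht]
  split_ifs with h
  · refine hs1 _ (div_ne_zero (fun h0 => ?_) hym)
    simp [h0] at h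
  · simp

lemma KillsOffEighthRoots.sum_four_charSum_sq {ψ : AddChar F ℂ} {m : ℕ}
    (H : KillsOffEighthRoots ψ m) (hψ : ψ.IsPrimitive) (hm : Odd m) {s : F → ℂ}
    (hs : ∀ z, s (-z) = -s z) (hs1 : ∀ z, z ≠ 0 → s z ^ 2 = 1) {ζ : F} (hζ : ζ ^ 4 = -1)
    (h2 : (-1 : F) ≠ 1) {y : F} (hy : y ≠ 0) :
    ∑ i : Fin 4, charSum ψ m s (ζ ^ (i : ℕ) * y) ^ 2 = -(4 * Fintype.card F) := by
  classical
  have hζ0 : ζ ≠ 0 := by rintro rfl; simp at hζ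
  set T : F → ℂ := fun y => ∑ i : Fin 4, charSum ψ m s (ζ ^ (i : ℕ) * y) ^ 2 with hT
  have T_zeta (x : F) : T (ζ * x) = T x := by
    have h4 : charSum ψ m s (ζ ^ 3 * (ζ * x)) ^ 2 = charSum ψ m s x ^ 2 := by
      rw [show ζ ^ 3 * (ζ * x) = ζ ^ 4 * x by ring, hζ, neg_one_mul, charSum_neg hm hs, neg_sq]
    simp only [hT, Fin.sum_univ_four, Fin.val_zero, Fin.val_one, Fin.val_two, pow_zero, one_mul,
      pow_one, show ((3 : Fin 4) : ℕ) = 3 from rfl, h4]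
    rw [show ζ ^ 2 * (ζ * x) = ζ ^ 3 * x by ring, show ζ * (ζ * x) = ζ ^ 2 * x by ring]
    ring
  have T_zeta_pow (j : ℕ) (x : F) : T (ζ ^ j * x) = T x := by
    induction j with
    | zero => simp
    | succ j ih => rw [pow_succ', mul_assoc, T_zeta, ih]
  have T_ker {l : F} (hl : l ^ m = 1) : T (l * y) = T y := by
    have hl0 : l ≠ 0 := by
      rintro rfl
      rw [zero_pow hm.pos.ne'] at hl
      exact zero_ne_one hl
    refine Finset.sum_congr rfl fun i _ => ?_
    have hc (x : F) (hx : x ≠ 0) : charSum ψ m s (l * x) = charSum ψ m s x := by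
      rw [mul_comm, charSum_mul s x hl0, hl]
      simp
    rw [mul_left_comm, hc _ (mul_ne_zero (pow_ne_zero _ hζ0) hy)]
  have hprim : IsPrimitiveRoot (ζ ^ m) 8 := by
    have h4 : (ζ ^ m) ^ 2 ^ 2 = -1 := by
      rw [← pow_mul, mul_comm, pow_mul, show 2 ^ 2 = 4 by norm_num, hζ, hm.neg_one_pow]
    refine IsPrimitiveRoot.iff_orderOf.2 (orderOf_eq_prime_pow (p := 2) (n := 2) ?_ ?_)
    · rwa [h4]
    · rw [pow_succ, pow_mul, h4]; ring
  have T_mul {l : F} (hl : (l ^ m) ^ 8 = 1) : T (l * y) = T y := by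
    obtain ⟨j, -, hj⟩ := hprim.eq_pow_of_pow_eq_one hl
    have hk : (l / ζ ^ j) ^ m = 1 := by
      rw [div_pow, ← hj, pow_right_comm, div_self (pow_ne_zero _ (pow_ne_zero _ hζ0))]
    rw [← T_ker hk, ← T_zeta_pow j (l / ζ ^ j * y), ← mul_assoc,
      mul_div_cancel₀ _ (pow_ne_zero j hζ0)]
  set N : ℂ := ∑ l : F, (if (l ^ m) ^ 8 = 1 then 1 else 0) with hN
  have hN0 : N ≠ 0 := by
    rw [hN, Finset.sum_boole, Nat.cast_ne_zero, Finset.card_ne_zero]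
    exact ⟨1, by simp⟩
  refine mul_left_cancel₀ hN0 ?_
  calc N * T y = ∑ l, (if (l ^ m) ^ 8 = 1 then T (l * y) else 0) := by
        rw [hN, Finset.sum_mul]
        refine Finset.sum_congr rfl fun l _ => ?_
        split_ifs with h
        · rw [T_mul h, one_mul]
        · rw [zero_mul]
    _ = ∑ i : Fin 4, ∑ l, (if (l ^ m) ^ 8 = 1
          then charSum ψ m s (l * (ζ ^ (i : ℕ) * y)) ^ 2 else 0) := by
        rw [Finset.sum_comm]
        refine Finset.sum_congr rfl fun l _ => ?_
        split_ifs with h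
        · simp only [hT, mul_left_comm]
        · simp
    _ = N * -(4 * Fintype.card F) := by
        simp_rw [H.sum_charSum_sq_mul hψ hm hs hs1 (mul_ne_zero (pow_ne_zero _ hζ0) hy)]
        rw [← hN]
        simp
        ring

lemma eq_of_fourier_eq {ψ : AddChar F ℂ} (hψ : ψ.IsPrimitive) {u v : F → ℂ}
    (h : ∀ y, ∑ t, u t * ψ (t * y) = ∑ t, v t * ψ (t * y)) : u = v := by
  classical
  have inversion (w : F → ℂ) (x : F) :
      ∑ y, (∑ t, w t * ψ (t * y)) * ψ (y * -x) = w x * Fintype.card F := by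
    simp_rw [Finset.sum_mul]
    rw [Finset.sum_comm]
    have (t y : F) : w t * ψ (t * y) * ψ (y * -x) = w t * ψ (y * (t - x)) := by
      rw [mul_assoc, ← AddChar.map_add_eq_mul]; ring_nf
    simp_rw [this, ← Finset.mul_sum, AddChar.sum_mulShift _ hψ, sub_eq_zero]
    simp
  funext x
  have hc : (Fintype.card F : ℂ) ≠ 0 := Nat.cast_ne_zero.2 Fintype.card_ne_zero
  refine mul_right_cancel₀ hc ?_
  rw [← inversion u x, ← inversion v x]
  simp_rw [h]

lemma sum_convolution_mul_addChar (ψ : AddChar F ℂ) (u v : F → ℂ) (y : F) :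
    ∑ t, (∑ z, u (t - z) * v z) * ψ (t * y) =
      (∑ x, u x * ψ (x * y)) * ∑ x, v x * ψ (x * y) := by
  rw [Finset.sum_mul_sum]
  conv_rhs => rw [Finset.sum_comm]
  simp_rw [Finset.sum_mul]
  rw [Finset.sum_comm]
  refine Finset.sum_congr rfl fun z _ => ?_
  rw [← Equiv.sum_comp (Equiv.addRight z)]
  refine Finset.sum_congr rfl fun x _ => ?_
  rw [Equiv.coe_addRight, add_sub_cancel_right, add_mul, AddChar.map_add_eq_mul]
  ring

/-- A finite field of characteristic other than two carries an odd sign function. -/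
lemma exists_odd_sign (h2 : (-1 : F) ≠ 1) :
    ∃ s : F → ℝ, (∀ z, s (-z) = -s z) ∧ ∀ z, z ≠ 0 → s z = 1 ∨ s z = -1 := by
  let _ : LinearOrder F := LinearOrder.lift' (Fintype.equivFin F) (Fintype.equivFin F).injective
  have hne (z : F) (hz : z ≠ 0) : z ≠ -z := by
    intro h
    refine h2 (mul_right_cancel₀ hz ?_)
    rw [neg_one_mul, one_mul, ← h]
  refine ⟨fun z => if z < -z then 1 else if -z < z then -1 else 0, fun z => ?_, fun z hz => ?_⟩
  · simp only [neg_neg]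
    rcases lt_trichotomy z (-z) with h | h | h
    · simp [h, h.not_gt]
    · simp [← h]
    · simp [h, h.not_gt]
  · rcases lt_or_gt_of_ne (hne z hz) with h | h
    · simp [h]
    · simp [h, h.not_gt]

/-- If `|F|` is a power of a prime power congruent to `9` modulo `16`, there are four odd
`±1`-valued functions on `F \ {0}` that form a difference family. -/
lemma exists_skew_difference_family (p : ℕ) [Fact p.Prime] [CharP F p] {a e : ℕ}
    (ha : p ^ a % 16 = 9) (hF : Fintype.card F = (p ^ a) ^ e) [DecidableEq F] :
    ∃ f : Fin 4 → F → ℝ, (∀ i x, f i (-x) = -f i x) ∧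
      (∀ i x, x ≠ 0 → f i x = 1 ∨ f i x = -1) ∧
      ∀ t, ∑ i, ∑ z, f i (t - z) * f i z = 4 - 4 * Fintype.card F * (if t = 0 then 1 else 0) := by
  have hp2 : p ≠ 2 := by
    rintro rfl
    rcases eq_or_ne a 0 with rfl | h0
    · simp at ha
    · have := Nat.even_pow.2 ⟨even_two, h0⟩
      rw [Nat.even_iff] at this
      omega
  have hchar : ringChar F ≠ 2 := by rwa [ringChar.eq F p]
  have h2 : (-1 : F) ≠ 1 := Ring.neg_one_ne_one_of_char_ne_two hchar
  have hQ8 : Fintype.card F % 8 = 1 := by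
    rw [hF, Nat.pow_mod, show p ^ a % 8 = 1 by omega, one_pow, Nat.one_mod]
  have hQ1 : 1 < Fintype.card F := Fintype.one_lt_card
  obtain ⟨n, m, hm, hnm⟩ := Nat.exists_eq_two_pow_mul_odd (n := Fintype.card F - 1) (by omega)
  obtain ⟨ζ, hζ⟩ : ∃ ζ : F, ζ ^ 4 = -1 := by
    obtain ⟨k, hk⟩ : ∃ k, Fintype.card F / 2 = 4 * k := ⟨Fintype.card F / 8, by omega⟩
    obtain ⟨i, hi⟩ : IsSquare (-1 : F) := by
      rw [FiniteField.isSquare_iff hchar (neg_ne_zero.2 one_ne_zero), hk, pow_mul]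
      norm_num
    have hi0 : i ≠ 0 := by rintro rfl; simp at hi
    obtain ⟨ζ, rfl⟩ : IsSquare i := by
      rw [FiniteField.isSquare_iff hchar hi0, hk, pow_mul, show i ^ 4 = (i * i) * (i * i) by ring,
        ← hi]
      norm_num
    exact ⟨ζ, by rw [hi]; ring⟩
  have hζ0 : ζ ≠ 0 := by rintro rfl; simp at hζ
  obtain ⟨ψ, hψ, hψp⟩ := exists_primitive_addChar_frobenius_invariant F p
  have H : KillsOffEighthRoots ψ m := fun s hs hs8 => by
    have hroot (x : F) (hx : x ≠ 0) : (x ^ m) ^ 2 ^ n = 1 := by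
      rw [← pow_mul, mul_comm, ← hnm, FiniteField.pow_card_sub_one_eq_one x hx]
    simpa [charSum] using sum_eq_zero_of_frobenius_invariant p ha hroot hψp hs hs8
  obtain ⟨s, hs, hs1⟩ := exists_odd_sign h2
  have hsC (z : F) : (s (-z) : ℂ) = -s z := by rw [hs, Complex.ofReal_neg]
  have hs1C (z : F) (hz : z ≠ 0) : (s z : ℂ) ^ 2 = 1 := by
    rcases hs1 z hz with h | h <;> simp [h]
  refine ⟨fun i x => s ((x / ζ ^ (i : ℕ)) ^ m), fun i x => ?_, fun i x hx => ?_, fun t => ?_⟩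
  · simp only [neg_div, hm.neg_pow, hs]
  · exact hs1 _ (pow_ne_zero _ (div_ne_zero hx (pow_ne_zero _ hζ0)))
  have transform (i : Fin 4) (y : F) :
      ∑ x, (s ((x / ζ ^ (i : ℕ)) ^ m) : ℂ) * ψ (x * y) =
        charSum ψ m (fun z => (s z : ℂ)) (ζ ^ (i : ℕ) * y) := by
    rw [mul_comm, charSum_mul _ _ (pow_ne_zero _ hζ0)]
    simp only [charSum, div_pow]
  have key : (fun t => ∑ i : Fin 4, ∑ z, (s (((t - z) / ζ ^ (i : ℕ)) ^ m) : ℂ) *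
        s ((z / ζ ^ (i : ℕ)) ^ m)) =
      fun t => 4 - 4 * (Fintype.card F : ℂ) * (if t = 0 then 1 else 0) := by
    refine eq_of_fourier_eq hψ fun y => ?_
    simp_rw [Finset.sum_mul (s := (Finset.univ : Finset (Fin 4)))]
    rw [Finset.sum_comm]
    have convolution (i : Fin 4) :
        ∑ t, (∑ z, (s (((t - z) / ζ ^ (i : ℕ)) ^ m) : ℂ) * s ((z / ζ ^ (i : ℕ)) ^ m)) *
          ψ (t * y) = charSum ψ m (fun z => (s z : ℂ)) (ζ ^ (i : ℕ) * y) ^ 2 := by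
      rw [sq, ← transform]
      exact sum_convolution_mul_addChar ψ (fun x => (s ((x / ζ ^ (i : ℕ)) ^ m) : ℂ)) _ y
    simp_rw [convolution, sub_mul, Finset.sum_sub_distrib, ← Finset.mul_sum,
      AddChar.sum_mulShift _ hψ]
    rcases eq_or_ne y 0 with rfl | hy
    · simp [charSum_zero (s := fun z => (s z : ℂ)) hm hsC]
    · rw [H.sum_four_charSum_sq hψ hm hsC hs1C hζ h2 hy]
      simp [hy]
  have := congrFun key t
  refine Complex.ofReal_injective ?_
  push_cast
  rw [this]
  split_ifs <;> simp

end CharacterSums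

/-- The Goethals–Seidel array over a ring. -/
def goethalsSeidel {R : Type*} [Ring R] (a b c d b' c' d' : R) : Matrix (Fin 4) (Fin 4) R :=
  !![a, b, c, d; -b, a, d', -c'; -c, -d', a, b'; -d, c', -b', a]

lemma goethalsSeidel_mul_self {R : Type*} [Ring R] {a k : R} {x x' : Fin 3 → R}
    (ha : ∀ i, a * x i + x i * a = 0) (ha' : ∀ i, a * x' i + x' i * a = 0)
    (hx : ∀ i j, x i * x' j = x j * x' i) (hx' : ∀ i j, x' i * x j = x' j * x i)
    (hxx : ∀ i j, x' i * x' j = x j * x i)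
    (hk : a * a - x 0 * x 0 - x 1 * x 1 - x 2 * x 2 = k) :
    goethalsSeidel a (x 0) (x 1) (x 2) (x' 0) (x' 1) (x' 2) *
      goethalsSeidel a (x 0) (x 1) (x 2) (x' 0) (x' 1) (x' 2) = Matrix.diagonal fun _ => k := by
  ext i j
  fin_cases i <;> fin_cases j <;>
    simp [goethalsSeidel, Matrix.mul_apply, Fin.sum_univ_four] <;>
    grind

lemma goethalsSeidel_skew_apply {R S : Type*} [Ring R] [AddGroup S] (φ ψ : R →+ S) {a : R}
    {x x' : Fin 3 → R} (ha : φ a = -ψ a) (hx : ∀ i, φ (x i) = ψ (x i))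
    (hx' : ∀ i, φ (x' i) = ψ (x' i)) (i j : Fin 4) :
    φ (goethalsSeidel a (x 0) (x 1) (x 2) (x' 0) (x' 1) (x' 2) j i) =
      -ψ (goethalsSeidel a (x 0) (x 1) (x 2) (x' 0) (x' 1) (x' 2) i j) := by
  fin_cases i <;> fin_cases j <;> simp [goethalsSeidel, hx, hx', ha]

lemma goethalsSeidel_eq_one_or {R S : Type*} [Ring R] [Ring S] (φ : R →+ S) {a : R}
    {x x' : Fin 3 → R} {i j : Fin 4} (ha : i = j → φ a = 1 ∨ φ a = -1)
    (hx : ∀ i, φ (x i) = 1 ∨ φ (x i) = -1) (hx' : ∀ i, φ (x' i) = 1 ∨ φ (x' i) = -1) :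
    φ (goethalsSeidel a (x 0) (x 1) (x 2) (x' 0) (x' 1) (x' 2) i j) = 1 ∨
      φ (goethalsSeidel a (x 0) (x 1) (x 2) (x' 0) (x' 1) (x' 2) i j) = -1 := by
  have hneg {r : R} (hr : φ r = 1 ∨ φ r = -1) : φ (-r) = 1 ∨ φ (-r) = -1 := by
    rw [map_neg, neg_eq_iff_eq_neg, neg_inj]
    exact hr.symm
  fin_cases i <;> fin_cases j <;>
    first
    | exact ha rfl
    | exact hx _
    | exact hx' _
    | exact hneg (hx _)
    | exact hneg (hx' _)

section Bordered

variable {F : Type*} [Field F] [Fintype F] [DecidableEq F]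

/-- The permutation matrix of negation. -/
def negMatrix (F : Type*) [Field F] [DecidableEq F] : Matrix F F ℝ :=
  of fun x y => if x = -y then 1 else 0

lemma mul_negMatrix_apply (P : Matrix F F ℝ) (x y : F) : (P * negMatrix F) x y = P x (-y) := by
  simp [negMatrix, Matrix.mul_apply]

lemma negMatrix_mul_apply (P : Matrix F F ℝ) (x y : F) : (negMatrix F * P) x y = P (-x) y := by
  simp [negMatrix, Matrix.mul_apply, eq_comm (a := x), neg_eq_iff_eq_neg]

lemma negMatrix_mul_self : negMatrix F * negMatrix F = 1 := by
  ext x y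
  rw [mul_negMatrix_apply]
  simp [negMatrix, Matrix.one_apply]

lemma negMatrix_mul_circulant {f : F → ℝ} (hf : ∀ x, f (-x) = -f x) :
    negMatrix F * circulant f = -(circulant f * negMatrix F) := by
  ext x y
  rw [Matrix.neg_apply, mul_negMatrix_apply, negMatrix_mul_apply, circulant_apply,
    circulant_apply, ← hf]
  congr 1
  ring

/-- A square matrix bordered by a corner entry and constant rows and columns. -/
def bordered (u v w : ℝ) (P : Matrix F F ℝ) : Matrix (Unit ⊕ F) (Unit ⊕ F) ℝ :=
  fromBlocks (of fun _ _ => u) (of fun _ _ => v) (of fun _ _ => w) P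

lemma bordered_mul {F : Type*} [Fintype F] {u v w u' v' w' r s : ℝ} {P P' : Matrix F F ℝ}
    (hP : ∀ x, ∑ y, P x y = r) (hP' : ∀ y, ∑ x, P' x y = s) :
    bordered u v w P * bordered u' v' w' P' =
      bordered (u * u' + Fintype.card F * (v * w')) (u * v' + v * s) (w * u' + r * w')
        ((w * v') • (of fun _ _ => 1) + P * P') := by
  rw [bordered, bordered, bordered, fromBlocks_multiply]
  congr 1 <;> ext i j
  · simp [Matrix.mul_apply]
  · simp [Matrix.mul_apply, ← Finset.mul_sum, hP']
  · simp [Matrix.mul_apply, ← Finset.sum_mul, hP]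
  · simp [Matrix.mul_apply]

lemma sum_odd_eq_zero {F : Type*} [Field F] [Fintype F] {f : F → ℝ} (hf : ∀ x, f (-x) = -f x) :
    ∑ x, f x = 0 := by
  rw [← self_eq_neg, ← Finset.sum_neg_distrib, ← Equiv.sum_comp (Equiv.neg F)]
  simp [hf]

/-- The off-diagonal blocks of the array. -/
def borderedReflected (f : F → ℝ) : Matrix (Unit ⊕ F) (Unit ⊕ F) ℝ :=
  bordered (-1) 1 1 ((1 + circulant f) * negMatrix F)

lemma circulant_row_sum {F : Type*} [Field F] [Fintype F] {f : F → ℝ}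
    (hf : ∀ x, f (-x) = -f x) (x : F) :
    ∑ y, circulant f x y = 0 := by
  rw [← sum_odd_eq_zero hf, ← Equiv.sum_comp (Equiv.subLeft x)]
  simp

lemma circulant_col_sum {F : Type*} [Field F] [Fintype F] {f : F → ℝ}
    (hf : ∀ x, f (-x) = -f x) (y : F) :
    ∑ x, circulant f x y = 0 := by
  rw [← sum_odd_eq_zero hf, ← Equiv.sum_comp (Equiv.addRight y)]
  simp

lemma reflected_row_sum {f : F → ℝ} (hf : ∀ x, f (-x) = -f x) (x : F) :
    ∑ y, ((1 + circulant f) * negMatrix F) x y = 1 := by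
  have h (y : F) : ((1 + circulant f) * negMatrix F) x y =
      (1 : Matrix F F ℝ) x (-y) + circulant f x (-y) := mul_negMatrix_apply _ _ _
  simp_rw [h]
  have h' : ∑ y, circulant f x (-y) = 0 :=
    (Equiv.sum_comp (Equiv.neg F) (circulant f x)).trans (circulant_row_sum hf x)
  rw [Finset.sum_add_distrib, h']
  simp [Matrix.one_apply, ← neg_eq_iff_eq_neg]

lemma reflected_col_sum {f : F → ℝ} (hf : ∀ x, f (-x) = -f x) (y : F) :
    ∑ x, ((1 + circulant f) * negMatrix F) x y = 1 := by
  have h (x : F) : ((1 + circulant f) * negMatrix F) x y =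
      (1 : Matrix F F ℝ) x (-y) + circulant f x (-y) := mul_negMatrix_apply _ _ _
  simp_rw [h]
  rw [Finset.sum_add_distrib, circulant_col_sum hf]
  simp [Matrix.one_apply]

lemma borderedReflected_mul {f g : F → ℝ} (hf : ∀ x, f (-x) = -f x) (hg : ∀ x, g (-x) = -g x) :
    borderedReflected f * borderedReflected g = bordered (1 + Fintype.card F) 0 0
      ((of fun _ _ => 1) + (1 + circulant f) * (1 - circulant g)) := by
  rw [borderedReflected, borderedReflected,
    bordered_mul (reflected_row_sum hf) (reflected_col_sum hg)]
  have : (1 + circulant f) * negMatrix F * ((1 + circulant g) * negMatrix F) =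
      (1 + circulant f) * (1 - circulant g) := by
    rw [mul_assoc (1 + circulant f), ← mul_assoc (negMatrix F), mul_add (negMatrix F), mul_one,
      negMatrix_mul_circulant hg, add_mul (negMatrix F), neg_mul, mul_assoc (circulant g),
      negMatrix_mul_self, mul_one, sub_eq_add_neg]
  rw [this]
  norm_num

lemma bordered_anticommute {f g : F → ℝ} (hf : ∀ x, f (-x) = -f x) (hg : ∀ x, g (-x) = -g x) :
    bordered 0 1 (-1) (circulant f) * borderedReflected g +
      borderedReflected g * bordered 0 1 (-1) (circulant f) = 0 := by
  rw [borderedReflected, bordered_mul (circulant_row_sum hf) (reflected_col_sum hg),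
    bordered_mul (reflected_row_sum hg) (circulant_col_sum hf)]
  have : (1 + circulant g) * negMatrix F * circulant f =
      -(circulant f * ((1 + circulant g) * negMatrix F)) := by
    rw [mul_assoc, negMatrix_mul_circulant hf, mul_neg, ← mul_assoc, ← mul_assoc, add_mul, mul_add,
      one_mul, mul_one, circulant_mul_comm g f]
  rw [this, bordered, bordered, fromBlocks_add]
  norm_num
  rw [← fromBlocks_zero]
  congr 1 <;> ext <;> simp [add_add_add_comm]

lemma bordered_add {F : Type*} (u v w u' v' w' : ℝ) (P P' : Matrix F F ℝ) :
    bordered u v w P + bordered u' v' w' P' = bordered (u + u') (v + v') (w + w') (P + P') :=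
  fromBlocks_add _ _ _ _ _ _ _ _

lemma bordered_neg {F : Type*} (u v w : ℝ) (P : Matrix F F ℝ) :
    -bordered u v w P = bordered (-u) (-v) (-w) (-P) :=
  fromBlocks_neg _ _ _ _

lemma bordered_scalar {F : Type*} [DecidableEq F] (c : ℝ) :
    bordered c 0 0 (c • (1 : Matrix F F ℝ)) = c • 1 := by
  rw [bordered, ← fromBlocks_one, fromBlocks_smul]
  congr 1 <;> ext <;> simp

lemma bordered_square_sum {f : Fin 4 → F → ℝ} (hf : ∀ i x, f i (-x) = -f i x)
    (hsum : ∀ t, ∑ i, ∑ z, f i (t - z) * f i z =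
      4 - 4 * Fintype.card F * (if t = 0 then 1 else 0)) :
    bordered 0 1 (-1) (circulant (f 0)) * bordered 0 1 (-1) (circulant (f 0)) -
      borderedReflected (f 1) * borderedReflected (f 1) -
      borderedReflected (f 2) * borderedReflected (f 2) -
      borderedReflected (f 3) * borderedReflected (f 3) =
    (-(4 * Fintype.card F + 3) : ℝ) • (1 : Matrix (Unit ⊕ F) (Unit ⊕ F) ℝ) := by
  have hsq : ∑ i, circulant (f i) * circulant (f i) =
      (4 : ℝ) • (of fun _ _ => 1) - (4 * Fintype.card F : ℝ) • (1 : Matrix F F ℝ) := by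
    ext x y
    rw [Matrix.sum_apply]
    simp_rw [circulant_mul, circulant_apply, Matrix.mulVec, dotProduct, circulant_apply]
    rw [hsum]
    simp [Matrix.one_apply, sub_eq_zero]
  rw [Fin.sum_univ_four] at hsq
  rw [bordered_mul (circulant_row_sum (hf 0)) (circulant_col_sum (hf 0)),
    borderedReflected_mul (hf 1) (hf 1), borderedReflected_mul (hf 2) (hf 2),
    borderedReflected_mul (hf 3) (hf 3), ← bordered_scalar]
  simp only [sub_eq_add_neg, bordered_neg, bordered_add]
  congr 1
  · ring
  · ring
  · ring
  · simp only [add_mul, mul_add, one_mul, mul_one, mul_neg]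
    rw [← sub_eq_zero] at hsq
    rw [← sub_eq_zero, ← hsq]
    module

lemma bordered_skew_apply {F : Type*} [Field F] {f : F → ℝ}
    (hf : ∀ x, f (-x) = -f x) (a b : Unit ⊕ F) :
    bordered 0 1 (-1) (circulant f) b a = -bordered 0 1 (-1) (circulant f) a b := by
  rcases a with a | a <;> rcases b with b | b <;> simp [bordered, ← hf]

lemma bordered_skew_eq_one_or {F : Type*} [Field F] {f : F → ℝ}
    (hf1 : ∀ x, x ≠ 0 → f x = 1 ∨ f x = -1)
    {a b : Unit ⊕ F} (hab : a ≠ b) :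
    bordered 0 1 (-1) (circulant f) a b = 1 ∨ bordered 0 1 (-1) (circulant f) a b = -1 := by
  rcases a with a | a <;> rcases b with b | b
  · exact absurd rfl hab
  · simp [bordered]
  · simp [bordered]
  · exact hf1 _ (sub_ne_zero.2 fun h => hab (by rw [h]))

lemma borderedReflected_inr_inr (f : F → ℝ) (x y : F) :
    borderedReflected f (Sum.inr x) (Sum.inr y) = (if x + y = 0 then 1 else 0) + f (x + y) := by
  have h : borderedReflected f (Sum.inr x) (Sum.inr y) =
      (1 : Matrix F F ℝ) x (-y) + circulant f x (-y) := mul_negMatrix_apply _ _ _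
  rw [h, Matrix.one_apply, circulant_apply, sub_neg_eq_add]
  simp only [eq_neg_iff_add_eq_zero]

lemma borderedReflected_symm (f : F → ℝ) (a b : Unit ⊕ F) :
    borderedReflected f b a = borderedReflected f a b := by
  rcases a with a | a <;> rcases b with b | b
  · rfl
  · simp [borderedReflected, bordered]
  · simp [borderedReflected, bordered]
  · simp only [borderedReflected_inr_inr, add_comm b a]

lemma borderedReflected_eq_one_or {f : F → ℝ} (hf0 : f 0 = 0)
    (hf1 : ∀ x, x ≠ 0 → f x = 1 ∨ f x = -1) (a b : Unit ⊕ F) :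
    borderedReflected f a b = 1 ∨ borderedReflected f a b = -1 := by
  rcases a with a | a <;> rcases b with b | b
  · simp [borderedReflected, bordered]
  · simp [borderedReflected, bordered]
  · simp [borderedReflected, bordered]
  · rw [borderedReflected_inr_inr]
    split_ifs with h
    · simp [h, hf0]
    · simpa using hf1 _ h

/-- A four-block skew difference family yields a skew Hadamard matrix by bordering the
Goethals–Seidel array. -/
lemma exists_skew_hadamard_of_difference_family {f : Fin 4 → F → ℝ}
    (hf : ∀ i x, f i (-x) = -f i x) (hf1 : ∀ i x, x ≠ 0 → f i x = 1 ∨ f i x = -1)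
    (hsum : ∀ t, ∑ i, ∑ z, f i (t - z) * f i z =
      4 - 4 * Fintype.card F * (if t = 0 then 1 else 0)) :
    ∃ H : Matrix (Fin 4 × (Unit ⊕ F)) (Fin 4 × (Unit ⊕ F)) ℝ,
      (∀ i j, H i j = 1 ∨ H i j = -1) ∧
      H * Hᵀ = (4 * (Fintype.card F + 1) : ℝ) • 1 ∧ (H - 1)ᵀ = -(H - 1) := by
  have hf' (i x) : (-f i) (-x) = -(-f i) x := by simp [hf]
  have hf0 (i) : f i 0 = 0 := self_eq_neg.1 (by simpa using hf i 0)
  set A := bordered 0 1 (-1) (circulant (f 0)) with hA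
  let X (i : Fin 3) := borderedReflected (f i.succ)
  let X' (i : Fin 3) := borderedReflected (-f i.succ)
  let G := goethalsSeidel A (X 0) (X 1) (X 2) (X' 0) (X' 1) (X' 2)
  have comm (i j) := circulant_mul_comm (f i) (f j)
  have hG : G * G = Matrix.diagonal fun _ => (-(4 * Fintype.card F + 3) : ℝ) • 1 := by
    refine goethalsSeidel_mul_self (fun i => bordered_anticommute (hf 0) (hf _))
      (fun i => bordered_anticommute (hf 0) (hf' _)) (fun i j => ?_) (fun i j => ?_)
      (fun i j => ?_) (bordered_square_sum hf hsum)
    · simp only [X, X', borderedReflected_mul, hf, hf', implies_true, circulant_neg,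
        sub_neg_eq_add, mul_add, add_mul, one_mul, mul_one, comm i.succ j.succ]
      congr 2; abel
    · simp only [X, X', borderedReflected_mul, hf, hf', implies_true, circulant_neg,
        mul_sub, add_mul, one_mul, mul_one, neg_mul, comm i.succ j.succ]
      congr 2; abel
    · simp only [X, X', borderedReflected_mul, hf, hf', implies_true, circulant_neg,
        sub_neg_eq_add, mul_add, mul_sub, add_mul, one_mul, mul_one, neg_mul, comm i.succ j.succ]
      congr 2; abel
  let S := Matrix.compRingEquiv (Fin 4) (Unit ⊕ F) ℝ G
  have hSS : S * S = (-(4 * Fintype.card F + 3) : ℝ) • 1 := by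
    rw [← map_mul, hG]
    ext ⟨i, a⟩ ⟨j, b⟩
    rcases eq_or_ne i j with rfl | hij
    · simp [Matrix.one_apply]
    · simp [hij]
  have hX (i a b) : X i b a = X i a b := borderedReflected_symm _ a b
  have hX' (i a b) : X' i b a = X' i a b := borderedReflected_symm _ a b
  have hAskew (a b) : A b a = -A a b := bordered_skew_apply (hf 0) a b
  have hX1 (i a b) : X i a b = 1 ∨ X i a b = -1 :=
    borderedReflected_eq_one_or (hf0 _) (hf1 _) a b
  have hX1' (i a b) : X' i a b = 1 ∨ X' i a b = -1 :=
    borderedReflected_eq_one_or (by simp [hf0])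
      (fun x hx => by rcases hf1 i.succ x hx with h | h <;> simp [h]) a b
  have hST : Sᵀ = -S := by
    ext ⟨i, a⟩ ⟨j, b⟩
    exact goethalsSeidel_skew_apply (Matrix.entryAddMonoidHom ℝ b a)
      (Matrix.entryAddMonoidHom ℝ a b) (hAskew a b) (fun i => hX i a b) (fun i => hX' i a b) i j
  have hS1 (i j a b) (h : (i, a) ≠ (j, b)) : S (i, a) (j, b) = 1 ∨ S (i, a) (j, b) = -1 := by
    exact goethalsSeidel_eq_one_or (Matrix.entryAddMonoidHom ℝ a b)
      (fun hij => bordered_skew_eq_one_or (hf1 0) fun hab => h (Prod.ext hij hab))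
      (fun i => hX1 i a b) (fun i => hX1' i a b)
  refine ⟨1 + S, fun i j => ?_, ?_, ?_⟩
  · rcases eq_or_ne i j with rfl | hij
    · left
      have := congrFun (congrFun hST i) i
      rw [Matrix.transpose_apply, Matrix.neg_apply, self_eq_neg] at this
      simp [this]
    · simpa [Matrix.one_apply, hij] using hS1 i.1 j.1 i.2 j.2 hij
  · rw [transpose_add, transpose_one, hST]
    have : (1 + S) * (1 + -S) = 1 - S * S := by noncomm_ring
    rw [this, hSS]
    module
  · rw [add_sub_cancel_left, hST]

end Bordered

/-- If `q ≡ 9 (mod 16)` is a prime power and `e ≥ 1`, then there exists a skew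
Hadamard matrix of order `4(q^e + 1)`: a `±1`-matrix `H` with
`H Hᵀ = n I` and `H = A + I` where `Aᵀ = -A`. -/
theorem skew_hadamard_matrix_of_order_four_qe_add_one
    (q : ℕ) (hq : IsPrimePow q) (hmod : q % 16 = 9) (e : ℕ) (he : 0 < e) :
    ∃ H : Matrix (Fin (4 * (q ^ e + 1))) (Fin (4 * (q ^ e + 1))) ℝ,
      (∀ i j, H i j = 1 ∨ H i j = -1) ∧
      H * Hᵀ = ((4 * (q ^ e + 1) : ℕ) : ℝ) • 1 ∧
      (H - 1)ᵀ = -(H - 1) := by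
  classical
  obtain ⟨p, a, hp, ha, rfl⟩ := (isPrimePow_nat_iff q).1 hq
  have : Fact p.Prime := ⟨hp⟩
  let F := GaloisField p (a * e)
  let _ : Fintype F := Fintype.ofFinite F
  have hF : Fintype.card F = (p ^ a) ^ e := by
    rw [← Nat.card_eq_fintype_card, GaloisField.card p _ (Nat.mul_pos ha he).ne', pow_mul]
  obtain ⟨f, hf, hf1, hsum⟩ := exists_skew_difference_family p hmod hF
  obtain ⟨H, h1, hH, hskew⟩ := exists_skew_hadamard_of_difference_family hf hf1 hsum
  let σ : Fin (4 * ((p ^ a) ^ e + 1)) ≃ Fin 4 × (Unit ⊕ F) :=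
    (Fintype.equivFinOfCardEq (by simp [hF, add_comm])).symm
  refine ⟨H.submatrix σ σ, fun i j => h1 _ _, ?_, ?_⟩
  · rw [transpose_submatrix, submatrix_mul_equiv, hH, submatrix_smul, Pi.smul_apply,
      Pi.smul_apply, submatrix_one_equiv, hF]
    push_cast
    rfl
  · rw [← submatrix_one_equiv σ, ← Pi.sub_apply, ← Pi.sub_apply, ← submatrix_sub,
      transpose_submatrix, hskew, submatrix_neg]
    rfl
end
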